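/- arXiv:2302.08345 — 8 statements merged into one kernel-verified Lean document; each statement's English description precedes it below -/
import Mathlib

section
/- Let d, m, L, T be positive integers with m ≥ 1 and L ≥ 1, and suppose both L and m+L divide T. Let 𝒜 ⊆ ℝ^d, let 𝒜₀ = 𝒜 ∪ {0_d}, and let f : 𝒜₀^m × 𝒜₀ → ℝ satisfy |f(h, a)| ≤ R for all h ∈ 𝒜₀^m and a ∈ 𝒜₀, for some R ≥ 0. Let OPT be the supremum, over all sequences (a_1,…,a_T) ∈ 𝒜₀^T (extended by a_t = 0_d for t ≤ 0), of the total reward Σ_{t=1}^T f((a_{t−m},…,a_{t−1}), a_t). Suppose ã ∈ 𝒜₀^{m+L} attains the supremum of the proxy reward r̃ over 𝒜₀^{m+L}, and let (r̃_t)_{t=1}^T be the instantaneous rewards obtained by playing ã cyclically, i.e., by the sequence a_t = ã_{((t−1) mod (m+L))+1} with a_t = 0_d for t ≤ 0. Then OPT − Σ_{t=1}^T r̃_t ≤ 2mRT/(m+L). -/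
open Finset

/-- Instantaneous reward at time `t` of the (zero-padded, `ℤ`-indexed) sequence `a`,
under the reward function `f` with memory size `m`: the history is
`(a_{t-m}, …, a_{t-1})` and the action is `a_t`. -/
noncomputable def instReward {V : Type*} (m : ℕ) (f : (Fin m → V) → V → ℝ)
    (a : ℤ → V) (t : ℤ) : ℝ :=
  f (fun s => a (t - (m : ℤ) + (s.1 : ℤ))) (a t)

/-- Total reward of the sequence `a` over the horizon `t = 1, …, T`. -/
noncomputable def totalReward {V : Type*} (m : ℕ) (f : (Fin m → V) → V → ℝ)
    (T : ℕ) (a : ℤ → V) : ℝ :=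
  ∑ t ∈ Finset.Icc (1 : ℤ) (T : ℤ), instReward m f a t

/-- Proxy reward of a block `b` (indexed by `1, …, m+L`): only the rewards of the
last `L` actions are counted, with histories taken inside the block. -/
noncomputable def proxyReward {V : Type*} (m L : ℕ) (f : (Fin m → V) → V → ℝ)
    (b : ℕ → V) : ℝ :=
  ∑ i ∈ Finset.Icc (m + 1) (m + L), f (fun s => b (i - m + (s.1 : ℕ))) (b i)

/-- The `ℤ`-indexed sequence obtained by playing the block `b` (of length `p`)
cyclically: `a_t = b_{((t-1) mod p) + 1}` for `t ≥ 1`, and `a_t = 0` for `t ≤ 0`. -/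
noncomputable def cyclicSeq {V : Type*} [Zero V] (p : ℕ) (b : ℕ → V) (t : ℤ) : V :=
  if t ≤ 0 then 0 else b (((t - 1) % (p : ℤ)).toNat + 1)

/-- The set of achievable total rewards over horizon `T`, for zero-padded sequences
taking values in `A0` on `{1, …, T}`.  Its supremum is `OPT`. -/
noncomputable def rewardSet {V : Type*} [Zero V] (m : ℕ) (f : (Fin m → V) → V → ℝ)
    (A0 : Set V) (T : ℕ) : Set ℝ :=
  {x | ∃ a : ℤ → V, (∀ t : ℤ, t ≤ 0 → a t = 0) ∧
    (∀ t : ℤ, 1 ≤ t → t ≤ (T : ℤ) → a t ∈ A0) ∧ x = totalReward m f T a}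

theorem totalReward_eq_sum_range {V : Type*} (m : ℕ) (f : (Fin m → V) → V → ℝ) (T : ℕ)
    (a : ℤ → V) :
    totalReward m f T a = ∑ i ∈ Finset.range T, instReward m f a ((i : ℤ) + 1) := by
  unfold totalReward
  symm
  refine Finset.sum_bij (fun i _ => (i : ℤ) + 1) ?_ ?_ ?_ ?_
  · intro i hi
    simp only [Finset.mem_range] at hi
    simp only [Finset.mem_Icc]
    omega
  · intro i _ j _ h
    simpa using h
  · intro t ht
    simp only [Finset.mem_Icc] at ht
    refine ⟨(t - 1).toNat, ?_, ?_⟩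
    · simp only [Finset.mem_range]
      omega
    · omega
  · intro i _
    rfl

theorem proxyReward_eq_sum_range {V : Type*} (m L : ℕ) (f : (Fin m → V) → V → ℝ)
    (a : ℤ → V) (c : ℤ) :
    proxyReward m L f (fun i => a (c + i)) =
      ∑ j ∈ Finset.range L, instReward m f a (c + m + j + 1) := by
  unfold proxyReward
  symm
  refine Finset.sum_bij (fun j _ => m + 1 + j) ?_ ?_ ?_ ?_
  · intro i hi
    simp only [Finset.mem_range] at hi
    simp only [Finset.mem_Icc]
    omega
  · intro i _ j _ h
    simpa using h
  · intro t ht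
    simp only [Finset.mem_Icc] at ht
    refine ⟨t - (m + 1), ?_, ?_⟩
    · simp only [Finset.mem_range]
      omega
    · omega
  · intro j _
    unfold instReward
    congr 1
    · funext s
      congr 1
      have : m + 1 + j - m = j + 1 := by omega
      rw [this]
      push_cast
      ring
    · congr 1
      push_cast
      ring

theorem proxyReward_congr {V : Type*} (m L : ℕ) (f : (Fin m → V) → V → ℝ) {b b' : ℕ → V}
    (h : ∀ i ∈ Finset.Icc 1 (m + L), b i = b' i) :
    proxyReward m L f b = proxyReward m L f b' := by
  unfold proxyReward
  refine Finset.sum_congr rfl fun i hi => ?_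
  simp only [Finset.mem_Icc] at hi h
  congr 1
  · funext s
    have := s.2
    exact h _ (by omega)
  · exact h _ (by omega)

/-- The total reward over `K` blocks of length `m + L` differs from the sum of the proxy rewards
of the blocks by at most `m * R` per block. -/
theorem abs_totalReward_sub_sum_proxyReward_le {V : Type*} (m L : ℕ)
    (f : (Fin m → V) → V → ℝ) (R : ℝ) (A0 : Set V)
    (hf : ∀ (h : Fin m → V) (a : V), (∀ s, h s ∈ A0) → a ∈ A0 → |f h a| ≤ R)
    (a : ℤ → V) (K : ℕ) (ha : ∀ t : ℤ, t ≤ (((m + L) * K : ℕ) : ℤ) → a t ∈ A0) :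
    |totalReward m f ((m + L) * K) a -
      ∑ k ∈ Finset.range K, proxyReward m L f (fun i => a ((((m + L) * k : ℕ) : ℤ) + i))| ≤
      K * (m * R) := by
  induction K with
  | zero => simp [totalReward]
  | succ K ih =>
    have hK := ih fun t ht => ha t (ht.trans (by push_cast; nlinarith))
    have hfirst : |∑ j ∈ Finset.range m,
        instReward m f a ((((m + L) * K + j : ℕ) : ℤ) + 1)| ≤ m * R := by
      refine (Finset.abs_sum_le_sum_abs _ _).trans ?_
      refine (Finset.sum_le_card_nsmul _ _ R fun j hj => ?_).trans (by simp)
      have hj' := Finset.mem_range.1 hj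
      have hlt : (m + L) * K + j + 1 ≤ (m + L) * (K + 1) := by
        rw [mul_add]
        omega
      zify at hlt
      refine hf _ _ (fun s => ha _ ?_) (ha _ ?_)
      · have := s.2
        push_cast
        linarith [show (s.1 : ℤ) ≤ m by omega]
      · push_cast
        linarith
    have hsplit : totalReward m f ((m + L) * (K + 1)) a =
        totalReward m f ((m + L) * K) a +
          (∑ j ∈ Finset.range m, instReward m f a ((((m + L) * K + j : ℕ) : ℤ) + 1) +
            proxyReward m L f (fun i => a ((((m + L) * K : ℕ) : ℤ) + i))) := by
      rw [totalReward_eq_sum_range, totalReward_eq_sum_range, proxyReward_eq_sum_range,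
        Nat.mul_succ, Finset.sum_range_add, Finset.sum_range_add]
      congr 2
      refine Finset.sum_congr rfl fun j _ => ?_
      congr 1
      push_cast
      ring
    rw [abs_le] at hK hfirst ⊢
    rw [hsplit, Finset.sum_range_succ, Nat.cast_succ (R := ℝ) K]
    constructor <;> linarith [hK.1, hK.2, hfirst.1, hfirst.2]

theorem cyclicSeq_mul_add {V : Type*} [Zero V] (p : ℕ) (b : ℕ → V) (k i : ℕ)
    (hi : i ∈ Finset.Icc 1 p) : cyclicSeq p b (((p * k : ℕ) : ℤ) + i) = b i := by
  rw [Finset.mem_Icc] at hi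
  have hpos : (0 : ℤ) ≤ ((p * k : ℕ) : ℤ) := Int.natCast_nonneg _
  have hmod : (((p * k : ℕ) : ℤ) + i - 1) % (p : ℤ) = i - 1 := by
    rw [show ((p * k : ℕ) : ℤ) + i - 1 = (i - 1) + p * k by push_cast; ring,
      Int.add_mul_emod_self_left]
    exact Int.emod_eq_of_lt (by omega) (by omega)
  rw [cyclicSeq, if_neg (by omega), hmod]
  congr 1
  omega

theorem cyclicSeq_mem {V : Type*} [Zero V] {p : ℕ} (hp : 0 < p) {b : ℕ → V} {A0 : Set V}
    (h0 : 0 ∈ A0) (hb : ∀ i ∈ Finset.Icc 1 p, b i ∈ A0) (t : ℤ) : cyclicSeq p b t ∈ A0 := by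
  unfold cyclicSeq
  split_ifs
  · exact h0
  · have h1 := Int.emod_nonneg (t - 1) (show (p : ℤ) ≠ 0 by omega)
    have h2 := Int.emod_lt_of_pos (t - 1) (show (0 : ℤ) < p by omega)
    exact hb _ (Finset.mem_Icc.2 ⟨by omega, by omega⟩)

/-- approximation by cyclic policies: if `|f| ≤ R` on `𝒜₀ = 𝒜 ∪ {0}`
and `ã` maximizes the proxy reward over blocks in `𝒜₀^{m+L}`, then playing `ã`
cyclically has total reward within `2mRT/(m+L)` of `OPT`. -/
theorem stmt_0 (d m L T : ℕ) (hd : 0 < d) (hm : 1 ≤ m) (hL : 1 ≤ L) (hT : 0 < T)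
    (hLdvd : L ∣ T) (hmLdvd : (m + L) ∣ T)
    (𝒜 : Set (Fin d → ℝ)) (A0 : Set (Fin d → ℝ)) (hA0 : A0 = 𝒜 ∪ {0})
    (f : (Fin m → (Fin d → ℝ)) → (Fin d → ℝ) → ℝ) (R : ℝ) (hR : 0 ≤ R)
    (hf : ∀ (h : Fin m → (Fin d → ℝ)) (a : Fin d → ℝ),
      (∀ s, h s ∈ A0) → a ∈ A0 → |f h a| ≤ R)
    (atil : ℕ → (Fin d → ℝ))
    (hatil_mem : ∀ i ∈ Finset.Icc 1 (m + L), atil i ∈ A0)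
    (hatil_opt : ∀ b : ℕ → (Fin d → ℝ),
      (∀ i ∈ Finset.Icc 1 (m + L), b i ∈ A0) →
      proxyReward m L f b ≤ proxyReward m L f atil) :
    sSup (rewardSet m f A0 T) - totalReward m f T (cyclicSeq (m + L) atil) ≤
      2 * (m : ℝ) * R * (T : ℝ) / ((m : ℝ) + (L : ℝ)) := by
  obtain ⟨K, rfl⟩ := hmLdvd
  have h0 : (0 : Fin d → ℝ) ∈ A0 := by simp [hA0]
  have hp : 0 < m + L := by omega
  have hbound : 2 * (m : ℝ) * R * (((m + L) * K : ℕ) : ℝ) / ((m : ℝ) + (L : ℝ)) =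
      2 * (K * (m * R)) := by
    have : (m : ℝ) + L ≠ 0 := by positivity
    push_cast
    field_simp
  have hcyc := (abs_le.1 <| abs_totalReward_sub_sum_proxyReward_le m L f R A0 hf
    (cyclicSeq (m + L) atil) K fun t _ => cyclicSeq_mem hp h0 hatil_mem t).1
  rw [Finset.sum_congr rfl fun k _ => proxyReward_congr m L f
    (cyclicSeq_mul_add (m + L) atil k), Finset.sum_const, Finset.card_range] at hcyc
  rw [hbound, sub_le_iff_le_add]
  refine csSup_le ⟨_, fun _ => 0, fun _ _ => rfl, fun _ _ _ => h0, rfl⟩ ?_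
  rintro _ ⟨a, ha0, ha, rfl⟩
  have hmem : ∀ t : ℤ, t ≤ (((m + L) * K : ℕ) : ℤ) → a t ∈ A0 := fun t ht => by
    rcases le_or_gt t 0 with h | h
    · rw [ha0 t h]
      exact h0
    · exact ha t h ht
  have hopt := (abs_le.1 <| abs_totalReward_sub_sum_proxyReward_le m L f R A0 hf a K hmem).2
  have hblocks := Finset.sum_le_card_nsmul (Finset.range K)
    (fun k => proxyReward m L f (fun i => a ((((m + L) * k : ℕ) : ℤ) + i)))
    (proxyReward m L f atil) fun k hk => hatil_opt _ fun i hi => hmem _ <| by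
      have h1 : (m + L) * (k + 1) ≤ (m + L) * K :=
        Nat.mul_le_mul_left _ (Finset.mem_range.1 hk)
      have h2 := (Finset.mem_Icc.1 hi).2
      rw [Nat.mul_succ] at h1
      omega
  rw [Finset.card_range] at hblocks
  linarith
end

section
/- Let m ≥ 1, d = m+1, 𝒜 = {0_d, e_1, …, e_d} where (e_k) is the standard basis of ℝ^d, θ* = (1/√d, …, 1/√d), and γ ≤ 0 a real number. For a history h ∈ 𝒜^m and action a ∈ 𝒜, the instantaneous reward is f(h, a) = ⟨a, (I_d + Σ_{s=1}^m h_s h_sᵀ)^γ θ*⟩, which equals (1 + n_j(h))^γ/√d when a = e_j, where n_j(h) = #{s ≤ m : h_s = e_j}, and equals 0 when a = 0_d. Then every sequence (a_t)_{t=1}^T ∈ 𝒜^T (with a_t = 0_d for t ≤ 0) has total reward Σ_{t=1}^T f((a_{t−m},…,a_{t−1}), a_t) ≤ T/√d, and the cyclic sequence a_t = e_{((t−1) mod d)+1} attains total reward exactly T/√d; hence the optimal total reward OPT over 𝒜^T equals T/√d. -/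
open Finset Matrix

/-- Real power `M^γ` of a matrix, defined via the spectral decomposition when `M` is
Hermitian (applying `t ↦ t^γ` to the eigenvalues), and junk value `0` otherwise. -/
noncomputable def matRpow {n : Type*} [Fintype n] [DecidableEq n]
    (M : Matrix n n ℝ) (γ : ℝ) : Matrix n n ℝ :=
  if hM : M.IsHermitian then
    (hM.eigenvectorUnitary : Matrix n n ℝ) *
      Matrix.diagonal (fun i => hM.eigenvalues i ^ γ) *
      star (hM.eigenvectorUnitary : Matrix n n ℝ)
  else 0

/-- The sequence cycling through the standard basis of `ℝ^d`:
`a_t = e_{((t-1) mod d) + 1}` for `t ≥ 1`, and `a_t = 0` for `t ≤ 0`. -/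
noncomputable def cyclicBasis (d : ℕ) (hd : 0 < d) : ℤ → (Fin d → ℝ) := fun t =>
  if t ≤ 0 then 0 else Pi.single (⟨((t - 1) % (d : ℤ)).toNat % d, Nat.mod_lt _ hd⟩ : Fin d) 1

theorem matRpow_diagonal {n : Type*} [Fintype n] [DecidableEq n] (v : n → ℝ) (γ : ℝ) :
    matRpow (diagonal v) γ = diagonal (fun i => v i ^ γ) := by
  have hM : (diagonal v).IsHermitian := isHermitian_diagonal v
  rw [matRpow, dif_pos hM]
  have hmul : diagonal v * (hM.eigenvectorUnitary : Matrix n n ℝ) =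
      (hM.eigenvectorUnitary : Matrix n n ℝ) * diagonal hM.eigenvalues := by
    have h := hM.spectral_theorem
    rw [Unitary.conjStarAlgAut_apply] at h
    refine (congrArg (· * (hM.eigenvectorUnitary : Matrix n n ℝ)) h).trans ?_
    simp only [mul_assoc]
    rw [UnitaryGroup.star_mul_self, mul_one]
    rfl
  have hpow : (hM.eigenvectorUnitary : Matrix n n ℝ) * diagonal (fun i => hM.eigenvalues i ^ γ) =
      diagonal (fun i => v i ^ γ) * (hM.eigenvectorUnitary : Matrix n n ℝ) := by
    ext i j
    have h := congrFun (congrFun hmul i) j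
    rw [diagonal_mul, mul_diagonal] at h
    rw [diagonal_mul, mul_diagonal]
    by_cases hU : (hM.eigenvectorUnitary : Matrix n n ℝ) i j = 0
    · rw [hU, zero_mul, mul_zero]
    · have hv : v i = hM.eigenvalues j := by
        rw [mul_comm] at h
        exact mul_left_cancel₀ hU h
      rw [hv, mul_comm]
  rw [hpow, mul_assoc, Unitary.mul_star_self_of_mem hM.eigenvectorUnitary.2, mul_one]

theorem vecMulVec_self_eq_diagonal {n : Type*} [DecidableEq n] {v : n → ℝ}
    (hv : v ∈ ({0} ∪ Set.range (fun k : n => Pi.single k (1 : ℝ)) : Set (n → ℝ))) :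
    vecMulVec v v = diagonal v := by
  rcases hv with rfl | ⟨k, rfl⟩
  · simp
  · ext i j
    by_cases hi : i = k <;> by_cases hj : j = k <;> by_cases hij : i = j <;>
      simp_all [vecMulVec_apply]

theorem dotProduct_matRpow_mulVec {n ι : Type*} [Fintype n] [DecidableEq n] [Fintype ι]
    (h : ι → n → ℝ)
    (hh : ∀ s, h s ∈ ({0} ∪ Set.range (fun k : n => Pi.single k (1 : ℝ)) : Set (n → ℝ)))
    (k : n) (γ : ℝ) (θ : n → ℝ) :
    Pi.single k 1 ⬝ᵥ (matRpow (1 + ∑ s, vecMulVec (h s) (h s)) γ).mulVec θ =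
      (1 + ∑ s, h s k) ^ γ * θ k := by
  have hdiag : 1 + ∑ s, vecMulVec (h s) (h s) = diagonal (fun i => 1 + ∑ s, h s i) := by
    simp_rw [fun s => vecMulVec_self_eq_diagonal (hh s)]
    ext i j
    by_cases hij : i = j <;> simp [hij, Matrix.sum_apply, one_apply]
  rw [hdiag, matRpow_diagonal, single_one_dotProduct, mulVec_diagonal]

theorem cyclicBasis_mem (d : ℕ) (hd : 0 < d) (t : ℤ) :
    cyclicBasis d hd t ∈
      ({0} ∪ Set.range (fun k : Fin d => Pi.single k (1 : ℝ)) : Set (Fin d → ℝ)) := by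
  unfold cyclicBasis
  split_ifs
  · exact Or.inl rfl
  · exact Or.inr ⟨_, rfl⟩

theorem cyclicBasis_apply_eq_zero (d : ℕ) (hd : 0 < d) {t u : ℤ} (hut : u < t) (htu : t < u + d) :
    cyclicBasis d hd u (⟨((t - 1) % (d : ℤ)).toNat % d, Nat.mod_lt _ hd⟩ : Fin d) = 0 := by
  unfold cyclicBasis
  split_ifs
  · rfl
  · refine Pi.single_eq_of_ne (fun heq => ?_) _
    have hd' : (d : ℤ) ≠ 0 := by omega
    have h1 := Int.emod_nonneg (t - 1) hd'
    have h2 := Int.emod_nonneg (u - 1) hd'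
    have h3 := Int.emod_lt_of_pos (t - 1) (by omega : (0 : ℤ) < d)
    have h4 := Int.emod_lt_of_pos (u - 1) (by omega : (0 : ℤ) < d)
    rw [Fin.mk.injEq, Nat.mod_eq_of_lt (by omega), Nat.mod_eq_of_lt (by omega)] at heq
    have hmod : (t - 1) % (d : ℤ) = (u - 1) % (d : ℤ) := by omega
    have hdvd := Int.dvd_of_emod_eq_zero (Int.emod_eq_emod_iff_emod_sub_eq_zero.mp hmod)
    have := Int.le_of_dvd (by omega) hdvd
    omega

/-- in the LBM with `d = m+1`, actions `{0, e_1, …, e_d}`,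
`θ* = (1/√d, …, 1/√d)` and exponent `γ ≤ 0`, every sequence has total reward at most
`T/√d`, the cyclic basis sequence attains exactly `T/√d`, and hence `OPT = T/√d`. -/
theorem stmt_1 (m : ℕ) (hm : 1 ≤ m) (γ : ℝ) (hγ : γ ≤ 0) (T : ℕ)
    (d : ℕ) (hd : d = m + 1)
    (𝒜 : Set (Fin d → ℝ))
    (h𝒜 : 𝒜 = {0} ∪ Set.range (fun k : Fin d => Pi.single k (1 : ℝ)))
    (θstar : Fin d → ℝ) (hθ : θstar = fun _ => 1 / Real.sqrt d)
    (f : (Fin m → (Fin d → ℝ)) → (Fin d → ℝ) → ℝ)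
    (hf : ∀ (h : Fin m → (Fin d → ℝ)) (a : Fin d → ℝ),
      f h a = a ⬝ᵥ (matRpow (1 + ∑ s, vecMulVec (h s) (h s)) γ).mulVec θstar) :
    (∀ a : ℤ → (Fin d → ℝ), (∀ t : ℤ, t ≤ 0 → a t = 0) →
        (∀ t : ℤ, 1 ≤ t → t ≤ (T : ℤ) → a t ∈ 𝒜) →
        totalReward m f T a ≤ (T : ℝ) / Real.sqrt d) ∧
    totalReward m f T (cyclicBasis d (by omega)) = (T : ℝ) / Real.sqrt d ∧
    sSup (rewardSet m f 𝒜 T) = (T : ℝ) / Real.sqrt d := by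
  subst hd h𝒜 hθ
  have hbound : ∀ a : ℤ → (Fin (m + 1) → ℝ), (∀ t : ℤ, t ≤ 0 → a t = 0) →
      (∀ t : ℤ, 1 ≤ t → t ≤ (T : ℤ) →
        a t ∈ ({0} ∪ Set.range (fun k => Pi.single k (1 : ℝ)) : Set (Fin (m + 1) → ℝ))) →
      totalReward m f T a ≤ (T : ℝ) / Real.sqrt (m + 1 : ℕ) := by
    intro a ha0 haA
    have hterm : ∀ t ∈ Finset.Icc (1 : ℤ) T,
        instReward m f a t ≤ 1 / Real.sqrt (m + 1 : ℕ) := by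
      intro t ht
      rw [Finset.mem_Icc] at ht
      rw [instReward, hf]
      have hh : ∀ s : Fin m, a (t - (m : ℤ) + (s.1 : ℤ)) ∈
          ({0} ∪ Set.range (fun k => Pi.single k (1 : ℝ)) : Set (Fin (m + 1) → ℝ)) := by
        intro s
        rcases le_or_gt (t - (m : ℤ) + (s.1 : ℤ)) 0 with hs | hs
        · exact Or.inl (ha0 _ hs)
        · exact haA _ hs (by have := s.2; omega)
      rcases haA t ht.1 ht.2 with hat | ⟨k, hat⟩
      · rw [Set.mem_singleton_iff.mp hat, zero_dotProduct]
        positivity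
      · rw [← hat, dotProduct_matRpow_mulVec _ hh]
        refine mul_le_of_le_one_left (by positivity) (Real.rpow_le_one_of_one_le_of_nonpos ?_ hγ)
        refine le_add_of_nonneg_right (Finset.sum_nonneg fun s _ => ?_)
        rcases hh s with hs | ⟨j, hs⟩
        · rw [Set.mem_singleton_iff.mp hs]
          rfl
        · rw [← hs]
          exact (Pi.single_nonneg.mpr zero_le_one : (0 : Fin (m + 1) → ℝ) ≤ Pi.single j 1) k
    refine (Finset.sum_le_sum hterm).trans_eq ?_
    simp [div_eq_mul_inv]
  have hcyc : totalReward m f T (cyclicBasis (m + 1) (by omega)) =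
      (T : ℝ) / Real.sqrt (m + 1 : ℕ) := by
    have hterm : ∀ t ∈ Finset.Icc (1 : ℤ) T,
        instReward m f (cyclicBasis (m + 1) (by omega)) t = 1 / Real.sqrt (m + 1 : ℕ) := by
      intro t ht
      rw [Finset.mem_Icc] at ht
      have hat : cyclicBasis (m + 1) (by omega) t =
          Pi.single (⟨((t - 1) % ((m + 1 : ℕ) : ℤ)).toNat % (m + 1),
            Nat.mod_lt _ (by omega)⟩ : Fin (m + 1)) 1 :=
        if_neg (by omega)
      rw [instReward, hf, hat, dotProduct_matRpow_mulVec _ fun s => cyclicBasis_mem _ _ _,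
        Finset.sum_eq_zero, add_zero, Real.one_rpow, one_mul]
      intro s _
      have := s.2
      exact cyclicBasis_apply_eq_zero _ _ (by omega) (by push_cast; omega)
    rw [totalReward, Finset.sum_congr rfl hterm]
    simp [div_eq_mul_inv]
  refine ⟨hbound, hcyc, IsGreatest.csSup_eq ⟨?_, ?_⟩⟩
  · exact ⟨cyclicBasis (m + 1) (by omega), fun t ht => if_pos ht,
      fun t _ _ => cyclicBasis_mem _ _ t, hcyc.symm⟩
  · rintro x ⟨a, ha0, haA, rfl⟩
    exact hbound a ha0 haA
end

section
/- Let m ≥ 1, L ≥ 1, d = m+1, 𝒜 = {0_d, e_1, …, e_d} ⊆ ℝ^d, θ* = (1/√d, …, 1/√d), and γ ≤ 0 real, with instantaneous reward f(h, a) = ⟨a, (I_d + Σ_{s=1}^m h_s h_sᵀ)^γ θ*⟩ for h ∈ 𝒜^m, a ∈ 𝒜 (so f(h, e_j) = (1 + n_j(h))^γ/√d with n_j(h) = #{s : h_s = e_j}, and f(h, 0_d) = 0). Define the proxy reward of a block b ∈ 𝒜^{m+L} by r̃(b) = Σ_{i=m+1}^{m+L} f((b_{i−m},…,b_{i−1}),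 b_i). Then every block b ∈ 𝒜^{m+L} satisfies r̃(b) ≤ L/√d, and the block ã given by ã_i = 0_d for 1 ≤ i ≤ m and ã_{m+i} = e_{((i−1) mod d)+1} for 1 ≤ i ≤ L attains r̃(ã) = L/√d. -/
open Finset Matrix

/-- The block `ã`: `ã_i = 0` for `1 ≤ i ≤ m`, and `ã_{m+i} = e_{((i-1) mod d) + 1}`
for `1 ≤ i ≤ L`. -/
noncomputable def blockTilde (d m : ℕ) (hd : 0 < d) : ℕ → (Fin d → ℝ) := fun i =>
  if i ≤ m then 0 else Pi.single (⟨(i - m - 1) % d, Nat.mod_lt _ hd⟩ : Fin d) 1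

/-- `matRpow M γ` acts on an eigenvector of `M` with eigenvalue `μ` as `μ ^ γ`. -/
theorem matRpow_mulVec_of_mulVec_eq_smul {n : Type*} [Fintype n] [DecidableEq n]
    {M : Matrix n n ℝ} (hM : M.IsHermitian) (γ : ℝ) {x : n → ℝ} {μ : ℝ}
    (hx : M *ᵥ x = μ • x) : matRpow M γ *ᵥ x = μ ^ γ • x := by
  set U : Matrix n n ℝ := (hM.eigenvectorUnitary : Matrix n n ℝ) with hU
  have hUU : star U * U = 1 := Unitary.coe_star_mul_self hM.eigenvectorUnitary
  have hUU' : U * star U = 1 := Unitary.coe_mul_star_self hM.eigenvectorUnitary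
  have hspec : M = U * diagonal hM.eigenvalues * star U := by
    simpa [Unitary.conjStarAlgAut_apply, Function.comp_def] using hM.spectral_theorem
  have hdiag : diagonal hM.eigenvalues *ᵥ (star U *ᵥ x) = μ • (star U *ᵥ x) := by
    calc diagonal hM.eigenvalues *ᵥ (star U *ᵥ x)
        = (star U * U * diagonal hM.eigenvalues * star U) *ᵥ x := by
          rw [hUU, one_mul, mulVec_mulVec]
      _ = star U *ᵥ (M *ᵥ x) := by
          rw [mulVec_mulVec]
          conv_rhs => rw [hspec]
          simp only [Matrix.mul_assoc]
      _ = μ • (star U *ᵥ x) := by rw [hx, mulVec_smul]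
  have hpow : diagonal (fun i => hM.eigenvalues i ^ γ) *ᵥ (star U *ᵥ x)
      = μ ^ γ • (star U *ᵥ x) := by
    ext i
    have hi := congrFun hdiag i
    simp only [mulVec_diagonal, Pi.smul_apply, smul_eq_mul] at hi ⊢
    rcases mul_eq_mul_right_iff.mp hi with h | h
    · rw [h]
    · rw [h, mul_zero, mul_zero]
  rw [matRpow, dif_pos hM, ← hU, ← mulVec_mulVec, ← mulVec_mulVec, hpow, mulVec_smul,
    mulVec_mulVec, hUU', one_mulVec]

/-- The zero vector or a standard basis vector. -/
def IsZeroOrSingle {n : Type*} [DecidableEq n] (a : n → ℝ) : Prop :=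
  a = 0 ∨ ∃ k, a = Pi.single k 1

theorem IsZeroOrSingle.nonneg {n : Type*} [DecidableEq n] {a : n → ℝ}
    (ha : IsZeroOrSingle a) (j : n) : 0 ≤ a j := by
  rcases ha with rfl | ⟨k, rfl⟩
  · simp
  · by_cases h : j = k <;> simp [h]

theorem IsZeroOrSingle.vecMulVec_self {n : Type*} [DecidableEq n] {a : n → ℝ}
    (ha : IsZeroOrSingle a) : vecMulVec a a = diagonal a := by
  rcases ha with rfl | ⟨k, rfl⟩
  · ext i j
    simp [vecMulVec_apply, diagonal_apply]
  · ext i j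
    simp only [vecMulVec_apply, diagonal_apply, Pi.single_apply]
    grind

/-- The reward of a standard basis vector, given a history of zero or basis vectors. -/
theorem single_dotProduct_matRpow_mulVec {n ι : Type*} [Fintype n] [DecidableEq n] [Fintype ι]
    (h : ι → n → ℝ) (hh : ∀ s, IsZeroOrSingle (h s)) (γ : ℝ) (θ : n → ℝ) (k : n) :
    (Pi.single k 1 : n → ℝ) ⬝ᵥ (matRpow (1 + ∑ s, vecMulVec (h s) (h s)) γ).mulVec θ
      = (1 + ∑ s, h s k) ^ γ * θ k := by
  have hM : (1 + ∑ s, vecMulVec (h s) (h s)) = diagonal (fun i => 1 + ∑ s, h s i) := by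
    ext i j
    by_cases hij : i = j
    · subst hij
      simp [Matrix.sum_apply, (hh _).vecMulVec_self]
    · simp [Matrix.sum_apply, (hh _).vecMulVec_self, hij]
  rw [hM, matRpow_diagonal, single_one_dotProduct, mulVec_diagonal]

theorem isZeroOrSingle_blockTilde (d m : ℕ) (hd : 0 < d) (i : ℕ) :
    IsZeroOrSingle (blockTilde d m hd i) := by
  unfold blockTilde
  split_ifs
  · exact Or.inl rfl
  · exact Or.inr ⟨_, rfl⟩

/-- Within `m` steps before time `i`, the block `ã` never plays the action it plays at time `i`. -/
theorem blockTilde_apply_eq_zero {d m : ℕ} (hd : 0 < d) (hmd : m < d) {i j : ℕ} (hji : j < i)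
    (hij : i ≤ j + m) : blockTilde d m hd j ⟨(i - m - 1) % d, Nat.mod_lt _ hd⟩ = 0 := by
  unfold blockTilde
  split_ifs with hj
  · rfl
  · refine Pi.single_eq_of_ne (fun h => ?_) _
    have hmod : j - m - 1 ≡ i - m - 1 [MOD d] := (Fin.mk.inj_iff.mp h).symm
    have hdvd := (Nat.modEq_iff_dvd' (by omega)).mp hmod
    have := Nat.le_of_dvd (by omega) hdvd
    omega

/-- in the LBM with `d = m+1`, actions `{0, e_1, …, e_d}`,
`θ* = (1/√d, …, 1/√d)` and exponent `γ ≤ 0`, every block `b ∈ 𝒜^{m+L}` has proxy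
reward at most `L/√d`, and the block `ã` attains exactly `L/√d`. -/
theorem stmt_2 (m L : ℕ) (hm : 1 ≤ m) (hL : 1 ≤ L) (γ : ℝ) (hγ : γ ≤ 0)
    (d : ℕ) (hd : d = m + 1)
    (𝒜 : Set (Fin d → ℝ))
    (h𝒜 : 𝒜 = {0} ∪ Set.range (fun k : Fin d => Pi.single k (1 : ℝ)))
    (θstar : Fin d → ℝ) (hθ : θstar = fun _ => 1 / Real.sqrt d)
    (f : (Fin m → (Fin d → ℝ)) → (Fin d → ℝ) → ℝ)
    (hf : ∀ (h : Fin m → (Fin d → ℝ)) (a : Fin d → ℝ),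
      f h a = a ⬝ᵥ (matRpow (1 + ∑ s, vecMulVec (h s) (h s)) γ).mulVec θstar) :
    (∀ b : ℕ → (Fin d → ℝ), (∀ i ∈ Finset.Icc 1 (m + L), b i ∈ 𝒜) →
        proxyReward m L f b ≤ (L : ℝ) / Real.sqrt d) ∧
    proxyReward m L f (blockTilde d m (by omega)) = (L : ℝ) / Real.sqrt d := by
  have hcard : ((Finset.Icc (m + 1) (m + L)).card : ℝ) = L := by
    rw [Nat.card_Icc]; congr 1; omega
  have hpos : 0 ≤ 1 / Real.sqrt d := by positivity
  constructor
  · intro b hb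
    have hbs : ∀ i ∈ Finset.Icc 1 (m + L), IsZeroOrSingle (b i) := by
      intro i hi
      have := hb i hi
      rw [h𝒜] at this
      rcases this with h | ⟨k, hk⟩
      · exact Or.inl h
      · exact Or.inr ⟨k, hk.symm⟩
    have hle : proxyReward m L f b ≤ ∑ _i ∈ Finset.Icc (m + 1) (m + L), 1 / Real.sqrt d := by
      refine Finset.sum_le_sum fun i hi => ?_
      rw [Finset.mem_Icc] at hi
      rw [hf]
      rcases hbs i (Finset.mem_Icc.mpr ⟨by omega, by omega⟩) with h | ⟨k, hk⟩
      · rw [h, zero_dotProduct]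
        exact hpos
      · have hh : ∀ s : Fin m, IsZeroOrSingle (b (i - m + (s : ℕ))) := fun s =>
          hbs _ (Finset.mem_Icc.mpr ⟨by omega, by omega⟩)
        rw [hk, single_dotProduct_matRpow_mulVec _ hh, hθ]
        refine mul_le_of_le_one_left hpos (Real.rpow_le_one_of_one_le_of_nonpos ?_ hγ)
        exact le_add_of_nonneg_right (Finset.sum_nonneg fun s _ => (hh s).nonneg k)
    rwa [Finset.sum_const, nsmul_eq_mul, hcard, mul_one_div] at hle
  · have heq : proxyReward m L f (blockTilde d m (by omega))
        = ∑ _i ∈ Finset.Icc (m + 1) (m + L), 1 / Real.sqrt d := by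
      refine Finset.sum_congr rfl fun i hi => ?_
      rw [Finset.mem_Icc] at hi
      have hi' : blockTilde d m (by omega) i
          = Pi.single ⟨(i - m - 1) % d, Nat.mod_lt _ (by omega)⟩ 1 := if_neg (by omega)
      rw [hf, hi', single_dotProduct_matRpow_mulVec _
        (fun s => isZeroOrSingle_blockTilde d m _ _), Finset.sum_eq_zero, add_zero,
        Real.one_rpow, one_mul, hθ]
      exact fun s _ => blockTilde_apply_eq_zero _ (by omega) (by omega) (by omega)
    rw [heq, Finset.sum_const, nsmul_eq_mul, hcard, mul_one_div]
end

section
/- Let d ≥ 2, m = d−1, and let γ ≥ 2 be an integer. Consider the linear bandit with memory on ℝ^d with θ* = e_1 and memory matrix A(h_1,…,h_m) = ((I_d + Σ_{s=1}^m h_s h_sᵀ)⁻¹)^γ (the matrix inverse exists since I_d plus a positive semidefinite matrix is positive definite), with actions indexed by t ≥ 1 and past actions zero-padded (a_t = 0_d for t ≤ 0). Then: (i) the oracle greedy trajectory — defined recursively by taking g_t to be a maximizer over the closed Euclidean unit ball of a ↦ ⟨a, A(g_{t−m},…,g_{t−1}) e_1⟩ — is uniquely the constant sequence g_t = e_1,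 and its total reward over T steps equals Σ_{t=1}^T (1 + min(t−1, m))^{−γ}, which is at most m + (T−m) d^{−γ}; (ii) if d divides T, the cyclic sequence a_t = e_{((t−1) mod d)+1} has total reward exactly T/d. Consequently the regret of oracle greedy after T rounds is at least T(1/d − d^{−γ}) − m, which grows linearly in T. -/
open Finset Matrix

/-- The Euclidean norm of a vector of `ℝ^d`. -/
noncomputable def euclNorm {d : ℕ} (v : Fin d → ℝ) : ℝ := Real.sqrt (∑ i, v i ^ 2)

/-- The constant sequence playing `v` at every `t ≥ 1` (zero-padded for `t ≤ 0`). -/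
noncomputable def constSeq {V : Type*} [Zero V] (v : V) : ℤ → V := fun t =>
  if t ≤ 0 then 0 else v

/-- `g` is an oracle greedy trajectory: it is zero-padded, and at every `t ≥ 1` the
action `g t` maximizes the instantaneous reward `a ↦ f (g_{t-m}, …, g_{t-1}) a` over
the closed Euclidean unit ball. -/
noncomputable def IsGreedy {d : ℕ} (m : ℕ) (f : (Fin m → (Fin d → ℝ)) → (Fin d → ℝ) → ℝ)
    (g : ℤ → (Fin d → ℝ)) : Prop :=
  (∀ t : ℤ, t ≤ 0 → g t = 0) ∧
  ∀ t : ℤ, 1 ≤ t → euclNorm (g t) ≤ 1 ∧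
    ∀ a : Fin d → ℝ, euclNorm a ≤ 1 →
      f (fun s => g (t - (m : ℤ) + (s.1 : ℤ))) a ≤
        f (fun s => g (t - (m : ℤ) + (s.1 : ℤ))) (g t)

section EuclNorm

variable {d : ℕ}

theorem euclNorm_le_one_iff (v : Fin d → ℝ) : euclNorm v ≤ 1 ↔ v ⬝ᵥ v ≤ 1 := by
  simp [euclNorm, Real.sqrt_le_one, dotProduct, pow_two]

theorem euclNorm_single_one (i : Fin d) : euclNorm (Pi.single i (1 : ℝ)) ≤ 1 := by
  simp [euclNorm_le_one_iff]

theorem apply_le_one_of_euclNorm_le_one {v : Fin d → ℝ} (hv : euclNorm v ≤ 1) (i : Fin d) :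
    v i ≤ 1 := by
  rw [euclNorm_le_one_iff, dotProduct] at hv
  have h := Finset.single_le_sum (fun j _ => mul_self_nonneg (v j)) (Finset.mem_univ i)
  nlinarith

theorem eq_single_of_euclNorm_le_one {v : Fin d → ℝ} (hv : euclNorm v ≤ 1) {i : Fin d}
    (hi : 1 ≤ v i) : v = Pi.single i 1 := by
  have hle := apply_le_one_of_euclNorm_le_one hv i
  have hvi : v i = 1 := le_antisymm hle hi
  rw [euclNorm_le_one_iff, dotProduct,
    ← Finset.add_sum_erase _ _ (Finset.mem_univ i), hvi] at hv
  have hnn : ∀ j ∈ Finset.univ.erase i, 0 ≤ v j * v j := fun j _ => mul_self_nonneg _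
  have h0 := (Finset.sum_eq_zero_iff_of_nonneg hnn).1
    (le_antisymm (by linarith) (Finset.sum_nonneg hnn))
  ext j
  by_cases hj : j = i
  · subst hj; simpa using hvi
  · simpa [Pi.single_apply, hj] using h0 j (by simp [hj])

end EuclNorm

section GramMatrix

variable {d m : ℕ}

theorem posDef_one_add_sum_vecMulVec (h : Fin m → Fin d → ℝ) :
    ((1 : Matrix (Fin d) (Fin d) ℝ) + ∑ s, vecMulVec (h s) (h s)).PosDef := by
  refine Matrix.PosDef.one.add_posSemidef (Matrix.posSemidef_sum _ fun s _ => ?_)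
  simpa using Matrix.posSemidef_vecMulVec_self_star (h s)

theorem one_add_sum_vecMulVec_mulVec (h : Fin m → Fin d → ℝ) (v : Fin d → ℝ) :
    ((1 : Matrix (Fin d) (Fin d) ℝ) + ∑ s, vecMulVec (h s) (h s)) *ᵥ v =
      v + ∑ s, (h s ⬝ᵥ v) • h s := by
  simp [Matrix.add_mulVec, Matrix.sum_mulVec, Matrix.vecMulVec_mulVec]

theorem inv_pow_mulVec_of_mulVec_eq_smul {M : Matrix (Fin d) (Fin d) ℝ} (hM : M.PosDef)
    {v : Fin d → ℝ} {c : ℝ} (hc : c ≠ 0) (hv : M *ᵥ v = c • v) (n : ℕ) :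
    (M⁻¹ ^ n) *ᵥ v = (c ^ n)⁻¹ • v := by
  have hdet : IsUnit M.det := hM.det_pos.ne'.isUnit
  have hinv : M⁻¹ *ᵥ v = c⁻¹ • v := by
    calc M⁻¹ *ᵥ v = M⁻¹ *ᵥ (c⁻¹ • M *ᵥ v) := by rw [hv, inv_smul_smul₀ hc]
      _ = c⁻¹ • v := by
        rw [Matrix.mulVec_smul, Matrix.mulVec_mulVec, Matrix.nonsing_inv_mul _ hdet,
          Matrix.one_mulVec]
  induction n with
  | zero => simp
  | succ k ih =>
    rw [pow_succ, ← Matrix.mulVec_mulVec, hinv, Matrix.mulVec_smul, ih, smul_smul, pow_succ,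
      mul_inv, mul_comm]

/-- If all past actions are zero or basis vectors, a basis vector is an eigenvector of the
memory matrix, with eigenvalue determined by the number of times it has been played. -/
theorem dotProduct_inv_pow_mulVec_single (h : Fin m → Fin d → ℝ) (i : Fin d)
    (hh : ∀ s, h s = 0 ∨ ∃ j, h s = Pi.single j 1) (n : ℕ) (a : Fin d → ℝ) :
    a ⬝ᵥ ((((1 : Matrix (Fin d) (Fin d) ℝ) + ∑ s, vecMulVec (h s) (h s))⁻¹) ^ n) *ᵥ
        Pi.single i (1 : ℝ) =
      ((1 + #{s | h s i = 1} : ℝ) ^ n)⁻¹ * a i := by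
  have hs : ∀ s, (h s ⬝ᵥ Pi.single i (1 : ℝ)) • h s =
      (if h s i = 1 then (1 : ℝ) else 0) • (Pi.single i (1 : ℝ) : Fin d → ℝ) := by
    intro s
    rcases hh s with h0 | ⟨j, hj⟩
    · simp [h0]
    · by_cases hji : i = j
      · subst hji; simp [hj]
      · simp [hj, hji]
  have hpos : (0 : ℝ) < 1 + #{s | h s i = 1} := by positivity
  rw [inv_pow_mulVec_of_mulVec_eq_smul (posDef_one_add_sum_vecMulVec h) hpos.ne']
  · simp [dotProduct_smul]
  · rw [one_add_sum_vecMulVec_mulVec, Finset.sum_congr rfl fun s _ => hs s, ← Finset.sum_smul,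
      Finset.sum_boole, add_smul, one_smul]

theorem inv_pow_mulVec_dotProduct_self_le (h : Fin m → Fin d → ℝ) (v : Fin d → ℝ) (n : ℕ) :
    let w := ((((1 : Matrix (Fin d) (Fin d) ℝ) + ∑ s, vecMulVec (h s) (h s))⁻¹) ^ n) *ᵥ v
    w ⬝ᵥ w ≤ v ⬝ᵥ v := by
  induction n with
  | zero => simp
  | succ k ih =>
    simp only [pow_succ', ← Matrix.mulVec_mulVec] at ih ⊢
    set M := (1 : Matrix (Fin d) (Fin d) ℝ) + ∑ s, vecMulVec (h s) (h s) with hM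
    refine le_trans ?_ ih
    set x := (M⁻¹ ^ k) *ᵥ v
    set y := M⁻¹ *ᵥ x with hy
    have hdet : IsUnit M.det := (posDef_one_add_sum_vecMulVec h).det_pos.ne'.isUnit
    have hx : x = y + ∑ s, (h s ⬝ᵥ y) • h s := by
      rw [← one_add_sum_vecMulVec_mulVec, hy, Matrix.mulVec_mulVec, ← hM,
        Matrix.mul_nonsing_inv _ hdet, Matrix.one_mulVec]
    have hyx : y ⬝ᵥ y ≤ y ⬝ᵥ x := by
      rw [hx, dotProduct_add, dotProduct_sum, le_add_iff_nonneg_right]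
      refine Finset.sum_nonneg fun s _ => ?_
      rw [dotProduct_smul, dotProduct_comm, smul_eq_mul]
      exact mul_self_nonneg _
    have hsq : 0 ≤ (x - y) ⬝ᵥ (x - y) := Finset.sum_nonneg fun j _ => mul_self_nonneg _
    rw [sub_dotProduct, dotProduct_sub, dotProduct_sub, dotProduct_comm x y] at hsq
    linarith

theorem dotProduct_inv_pow_mulVec_le_one (h : Fin m → Fin d → ℝ) (n : ℕ) {a v : Fin d → ℝ}
    (ha : euclNorm a ≤ 1) (hv : euclNorm v ≤ 1) :
    a ⬝ᵥ ((((1 : Matrix (Fin d) (Fin d) ℝ) + ∑ s, vecMulVec (h s) (h s))⁻¹) ^ n) *ᵥ v ≤ 1 := by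
  rw [euclNorm_le_one_iff] at ha hv
  have hw := inv_pow_mulVec_dotProduct_self_le h v n
  simp only at hw
  set w := ((((1 : Matrix (Fin d) (Fin d) ℝ) + ∑ s, vecMulVec (h s) (h s))⁻¹) ^ n) *ᵥ v
  have hsq : 0 ≤ (a - w) ⬝ᵥ (a - w) := Finset.sum_nonneg fun j _ => mul_self_nonneg _
  rw [sub_dotProduct, dotProduct_sub, dotProduct_sub, dotProduct_comm w a] at hsq
  linarith

end GramMatrix

section Counting

theorem card_filter_one_le_sub_add (m : ℕ) {t : ℤ} (ht : 1 ≤ t) :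
    (#{s : Fin m | 1 ≤ t - (m : ℤ) + (s.1 : ℤ)} : ℤ) = min (t - 1) m := by
  have h : #{s : Fin m | 1 ≤ t - (m : ℤ) + (s.1 : ℤ)} =
      #(Finset.Ico (m + 1 - t).toNat m) := by
    refine Finset.card_bij (fun s _ => s.1) (fun s hs => ?_) (fun _ _ _ _ => Fin.ext) ?_
    · simp only [Finset.mem_filter, Finset.mem_univ, true_and] at hs
      simp only [Finset.mem_Ico]
      omega
    · intro b hb
      simp only [Finset.mem_Ico] at hb
      exact ⟨⟨b, hb.2⟩, by simp only [Finset.mem_filter, Finset.mem_univ, true_and]; omega, rfl⟩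
  rw [h, Nat.card_Ico]
  omega

theorem card_filter_Icc_emod_eq_zero {d T : ℕ} (hd : 0 < d) (hdvd : d ∣ T) :
    #{t ∈ Finset.Icc (1 : ℤ) T | (t - 1) % (d : ℤ) = 0} = T / d := by
  obtain ⟨k, rfl⟩ := hdvd
  have hset : {t ∈ Finset.Icc (1 : ℤ) (d * k : ℕ) | (t - 1) % (d : ℤ) = 0} =
      {t ∈ Finset.Ico (1 : ℤ) ((d * k : ℕ) + 1) | t ≡ 1 [ZMOD d]} := by
    ext t
    rw [Finset.mem_filter, Finset.mem_filter, Finset.mem_Icc, Finset.mem_Ico, Int.lt_add_one_iff,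
      Int.modEq_iff_dvd, dvd_sub_comm, Int.dvd_iff_emod_eq_zero]
  have h := Int.Ico_filter_modEq_card (1 : ℤ) ((d * k : ℕ) + 1) (by exact_mod_cast hd) (1 : ℤ)
    (r := (d : ℤ))
  rw [hset, Nat.mul_div_cancel_left _ hd]
  have hd' : (d : ℚ) ≠ 0 := by positivity
  simpa [hd'] using h

theorem sum_zpow_neg_le {d m T : ℕ} (γ : ℕ) (hd : d = m + 1) (hmT : m ≤ T) :
    ∑ t ∈ Finset.Icc (1 : ℤ) (T : ℤ), ((1 + min (t - 1) (m : ℤ) : ℤ) : ℝ) ^ (-(γ : ℤ)) ≤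
      (m : ℝ) + ((T : ℝ) - (m : ℝ)) * (d : ℝ) ^ (-(γ : ℤ)) := by
  set q : ℝ := (d : ℝ) ^ (-(γ : ℤ)) with hq
  have hterm : ∀ t ∈ Finset.Icc (1 : ℤ) (T : ℤ),
      ((1 + min (t - 1) (m : ℤ) : ℤ) : ℝ) ^ (-(γ : ℤ)) ≤
        q + if t ≤ (m : ℤ) then 1 - q else 0 := by
    intro t ht
    rw [Finset.mem_Icc] at ht
    split_ifs with htm
    · rw [min_eq_left (by omega), add_sub_cancel, add_sub_cancel, _root_.zpow_neg, zpow_natCast]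
      exact inv_le_one_of_one_le₀ (one_le_pow₀ (by exact_mod_cast ht.1))
    · rw [min_eq_right (by omega), hq, hd]
      push_cast
      rw [add_comm (1 : ℝ), add_zero]
  refine (Finset.sum_le_sum hterm).trans_eq ?_
  have hfilter : {t ∈ Finset.Icc (1 : ℤ) (T : ℤ) | t ≤ (m : ℤ)} = Finset.Icc (1 : ℤ) m := by
    ext t
    simp only [Finset.mem_filter, Finset.mem_Icc]
    omega
  rw [Finset.sum_add_distrib, ← Finset.sum_filter, hfilter]
  simp
  ring

end Counting

section Sequences

theorem constSeq_eq_zero_or_single {d : ℕ} (i : Fin d) (t : ℤ) :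
    constSeq (Pi.single i (1 : ℝ) : Fin d → ℝ) t = 0 ∨
      ∃ j : Fin d, constSeq (Pi.single i (1 : ℝ) : Fin d → ℝ) t = Pi.single j 1 := by
  unfold constSeq
  split_ifs
  exacts [Or.inl rfl, Or.inr ⟨i, rfl⟩]

theorem cyclicBasis_eq_zero_or_single {d : ℕ} (hd : 0 < d) (t : ℤ) :
    cyclicBasis d hd t = 0 ∨ ∃ j : Fin d, cyclicBasis d hd t = Pi.single j 1 := by
  unfold cyclicBasis
  split_ifs
  exacts [Or.inl rfl, Or.inr ⟨_, rfl⟩]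

theorem constSeq_single_apply_eq_one_iff {d : ℕ} (i : Fin d) (t : ℤ) :
    constSeq (Pi.single i (1 : ℝ) : Fin d → ℝ) t i = 1 ↔ 1 ≤ t := by
  unfold constSeq
  split_ifs with h
  · simp; omega
  · simp; omega

theorem cyclicBasis_apply_zero {d : ℕ} (hd : 0 < d) (t : ℤ) :
    cyclicBasis d hd t ⟨0, hd⟩ = if 1 ≤ t ∧ (t - 1) % (d : ℤ) = 0 then 1 else 0 := by
  have h1 := Int.emod_nonneg (t - 1) (b := d) (by omega)
  have h2 := Int.emod_lt_of_pos (t - 1) (b := d) (by omega)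
  have h3 : ((t - 1) % (d : ℤ)).toNat % d = ((t - 1) % (d : ℤ)).toNat :=
    Nat.mod_eq_of_lt (by omega)
  unfold cyclicBasis
  split_ifs with h h' h'
  · omega
  · rfl
  · simp [h'.2]
  · rw [Pi.single_apply, if_neg]
    rw [Fin.mk.injEq, h3]
    omega

end Sequences

/-- rotting instance where oracle greedy fails: with `m = d-1`,
`θ* = e₁`, memory matrix `((I + Σ h h ᵀ)⁻¹)^γ`, `γ ≥ 2`: the greedy trajectory is
uniquely the constant sequence `e₁`, its total reward is `Σ_{t=1}^T (1+min(t-1,m))^{-γ}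
≤ m + (T-m) d^{-γ}`; the cyclic basis sequence gets `T/d`; hence greedy's regret is at
least `T(1/d - d^{-γ}) - m`. -/
theorem stmt_4 (d : ℕ) (hd : 2 ≤ d) (m : ℕ) (hm : m = d - 1) (γ : ℕ) (hγ : 2 ≤ γ)
    (T : ℕ) (hT : 0 < T) (hdvd : d ∣ T)
    (f : (Fin m → (Fin d → ℝ)) → (Fin d → ℝ) → ℝ)
    (hf : ∀ (h : Fin m → (Fin d → ℝ)) (a : Fin d → ℝ),
      f h a = a ⬝ᵥ
        ((((1 : Matrix (Fin d) (Fin d) ℝ) + ∑ s, vecMulVec (h s) (h s))⁻¹) ^ γ).mulVec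
          (Pi.single (⟨0, by omega⟩ : Fin d) (1 : ℝ))) :
    -- (i) the constant sequence `e₁` is greedy, and it is the unique greedy trajectory
    IsGreedy m f (constSeq (Pi.single (⟨0, by omega⟩ : Fin d) (1 : ℝ))) ∧
    (∀ g : ℤ → (Fin d → ℝ), IsGreedy m f g →
      ∀ t : ℤ, 1 ≤ t → g t = Pi.single (⟨0, by omega⟩ : Fin d) (1 : ℝ)) ∧
    -- its total reward over `T` steps
    totalReward m f T (constSeq (Pi.single (⟨0, by omega⟩ : Fin d) (1 : ℝ))) =
      ∑ t ∈ Finset.Icc (1 : ℤ) (T : ℤ), ((1 + min (t - 1) (m : ℤ) : ℤ) : ℝ) ^ (-(γ : ℤ)) ∧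
    (∑ t ∈ Finset.Icc (1 : ℤ) (T : ℤ), ((1 + min (t - 1) (m : ℤ) : ℤ) : ℝ) ^ (-(γ : ℤ))) ≤
      (m : ℝ) + ((T : ℝ) - (m : ℝ)) * (d : ℝ) ^ (-(γ : ℤ)) ∧
    -- (ii) the cyclic basis sequence has total reward exactly `T/d`
    totalReward m f T (cyclicBasis d (by omega)) = (T : ℝ) / (d : ℝ) ∧
    -- consequently, the regret of oracle greedy is linear in `T`
    sSup (rewardSet m f {v : Fin d → ℝ | euclNorm v ≤ 1} T) -
        totalReward m f T (constSeq (Pi.single (⟨0, by omega⟩ : Fin d) (1 : ℝ))) ≥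
      (T : ℝ) * (1 / (d : ℝ) - (d : ℝ) ^ (-(γ : ℤ))) - (m : ℝ) := by
  have hd0 : 0 < d := by omega
  set i : Fin d := ⟨0, hd0⟩ with hi
  have hfs : ∀ (h : Fin m → (Fin d → ℝ)) (a : Fin d → ℝ),
      (∀ s, h s = 0 ∨ ∃ j, h s = Pi.single j 1) →
        f h a = ((1 + #{s | h s i = 1} : ℝ) ^ γ)⁻¹ * a i := fun h a hh => by
    rw [hf, dotProduct_inv_pow_mulVec_single h i hh]
  have hmT : m ≤ T := by have := Nat.le_of_dvd hT hdvd; omega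
  have hsum := sum_zpow_neg_le γ (show d = m + 1 by omega) hmT
  have hgreedy : totalReward m f T (constSeq (Pi.single i (1 : ℝ))) =
      ∑ t ∈ Finset.Icc (1 : ℤ) (T : ℤ),
        ((1 + min (t - 1) (m : ℤ) : ℤ) : ℝ) ^ (-(γ : ℤ)) := by
    refine Finset.sum_congr rfl fun t ht => ?_
    have ht1 := (Finset.mem_Icc.1 ht).1
    rw [instReward, hfs _ _ fun s => constSeq_eq_zero_or_single i _,
      (constSeq_single_apply_eq_one_iff i t).2 ht1, mul_one]
    simp only [constSeq_single_apply_eq_one_iff]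
    rw [← card_filter_one_le_sub_add m ht1]
    simp
  have hcyclic : totalReward m f T (cyclicBasis d hd0) = (T : ℝ) / (d : ℝ) := by
    have hterm : ∀ t ∈ Finset.Icc (1 : ℤ) (T : ℤ), instReward m f (cyclicBasis d hd0) t =
        if (t - 1) % (d : ℤ) = 0 then 1 else 0 := by
      intro t ht
      have ht1 := (Finset.mem_Icc.1 ht).1
      rw [instReward, hfs _ _ fun s => cyclicBasis_eq_zero_or_single hd0 _]
      simp only [hi, cyclicBasis_apply_zero, ht1, true_and]
      split_ifs with h0
      · rw [Finset.card_eq_zero.2]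
        · simp
        rw [Finset.filter_eq_empty_iff]
        intro s _ hs
        have hs' : (t - m + s.1 - 1) % (d : ℤ) = 0 := by
          by_contra hne
          simp [hne] at hs
        have hdiv := Int.dvd_sub (Int.dvd_of_emod_eq_zero h0) (Int.dvd_of_emod_eq_zero hs')
        have := Int.le_of_dvd (by omega) hdiv
        omega
      · simp
    rw [totalReward, Finset.sum_congr rfl hterm, Finset.sum_boole,
      card_filter_Icc_emod_eq_zero hd0 hdvd, Nat.cast_div hdvd (by positivity)]
  refine ⟨⟨fun t ht => by simp [constSeq, ht], fun t ht => ⟨?_, fun a ha => ?_⟩⟩, ?_, hgreedy,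
    hsum, hcyclic, ?_⟩
  · rw [constSeq, if_neg (by omega)]
    exact euclNorm_single_one i
  · rw [hfs _ _ fun s => constSeq_eq_zero_or_single i _,
      hfs _ _ fun s => constSeq_eq_zero_or_single i _,
      (constSeq_single_apply_eq_one_iff i t).2 ht]
    gcongr
    exact apply_le_one_of_euclNorm_le_one ha i
  · rintro g ⟨hg0, hg⟩ t ht
    induction t using Int.strongRec (m := 1) with
    | lt n hn => omega
    | ge n hn ih =>
      have hpast : ∀ s : Fin m, g (n - m + s.1) = 0 ∨ ∃ j, g (n - m + s.1) = Pi.single j 1 := by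
        intro s
        rcases le_or_gt (n - m + s.1) 0 with h | h
        · exact Or.inl (hg0 _ h)
        · exact Or.inr ⟨i, ih _ (by omega) (by omega)⟩
      obtain ⟨hball, hmax⟩ := hg n hn
      have h := hmax _ (euclNorm_single_one i)
      rw [hfs _ _ hpast, hfs _ _ hpast, Pi.single_eq_same] at h
      exact eq_single_of_euclNorm_le_one hball (le_of_mul_le_mul_left h (by positivity))
  · have hbdd : BddAbove (rewardSet m f {v : Fin d → ℝ | euclNorm v ≤ 1} T) := by
      refine ⟨T, ?_⟩
      rintro _ ⟨a, -, ha, rfl⟩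
      refine (Finset.sum_le_card_nsmul _ _ 1 fun t ht => ?_).trans_eq (by simp)
      rw [Finset.mem_Icc] at ht
      rw [instReward, hf]
      exact dotProduct_inv_pow_mulVec_le_one _ γ (ha t ht.1 ht.2) (euclNorm_single_one i)
    have hmem : (T : ℝ) / d ∈ rewardSet m f {v : Fin d → ℝ | euclNorm v ≤ 1} T := by
      refine ⟨cyclicBasis d hd0, fun t ht => by simp [cyclicBasis, ht], fun t ht _ => ?_,
        hcyclic.symm⟩
      rw [Set.mem_ofPred_eq, cyclicBasis, if_neg (by omega)]
      exact euclNorm_single_one _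
    have hopt := le_csSup hbdd hmem
    rw [← hgreedy] at hsum
    have hq : 0 ≤ (m : ℝ) * (d : ℝ) ^ (-(γ : ℤ)) := by positivity
    rw [div_eq_mul_one_div] at hopt
    linarith
end

section
/- Let m ≥ 1 be an integer and let 0 < ε < m/(m+1). Consider the linear bandit with memory on ℝ² with θ* = (ε, 1), initialization matrix A₀ = [[1,0],[0,0]], exponent γ = 1, and memory matrix A(h_1,…,h_m) = A₀ + Σ_{s=1}^m h_s h_sᵀ, with past actions zero-padded (a_t = 0 for t ≤ 0). Then: (i) the oracle greedy trajectory — defined recursively by taking g_t to be a maximizer over the closed Euclidean unit ball of a ↦ ⟨a, A(g_{t−m},…,g_{t−1}) θ*⟩ — is uniquely the constant sequence g_t = e_1 = (1,0), and its total reward over T steps equals Σ_{t=1}^T (1 + min(t−1, m)) ε ≤ T(m+1)ε; (ii) the constant sequence a_t = e_2 = (0,1) has total reward Σ_{t=1}^T min(t−1, m) ≥ (T−m)m. Consequently the regret of oracle greedy after T rounds is at least (T−m)m − T(m+1)ε, which grows linearly in T since ε < m/(m+1). -/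
open Finset Matrix

lemma euclNorm_fin_two_le_one_iff (v : Fin 2 → ℝ) :
    euclNorm v ≤ 1 ↔ v 0 ^ 2 + v 1 ^ 2 ≤ 1 := by
  rw [euclNorm, Real.sqrt_le_one, Fin.sum_univ_two]

lemma rising_reward_eq {m : ℕ} (ε : ℝ) (h : Fin m → (Fin 2 → ℝ)) (a : Fin 2 → ℝ) :
    a ⬝ᵥ (!![1, 0; 0, 0] + ∑ s, vecMulVec (h s) (h s)).mulVec ![ε, 1] =
      a 0 * ε + ∑ s, (a 0 * h s 0 + a 1 * h s 1) * (h s 0 * ε + h s 1) := by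
  simp only [add_mulVec, dotProduct_add, sum_mulVec, dotProduct_sum]
  congr 1
  · simp [dotProduct, mulVec, Fin.sum_univ_two]
  · refine Finset.sum_congr rfl fun s _ => ?_
    simp [dotProduct, mulVec, vecMulVec, Fin.sum_univ_two]
    ring

/-- The number of indices of the memory window at time `t` that are at least `1`
is `min (t - 1) m`. -/
lemma sum_window_ite (m : ℕ) (t : ℤ) (ht : 1 ≤ t) (c : ℝ) :
    ∑ s : Fin m, (if t - (m : ℤ) + (s.1 : ℤ) ≤ 0 then 0 else c) =
      ((min (t - 1) (m : ℤ) : ℤ) : ℝ) * c := by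
  induction m with
  | zero => simp [min_eq_right (sub_nonneg.2 ht)]
  | succ m ih =>
    have hshift : ∀ s : Fin m, t - ((m + 1 : ℕ) : ℤ) + ((s.succ : Fin (m + 1)).1 : ℤ) =
        t - (m : ℤ) + (s.1 : ℤ) := fun s => by
      rw [Fin.val_succ]; push_cast; ring
    rw [Fin.sum_univ_succ]
    simp only [hshift]
    rw [ih]
    by_cases h : t ≤ (m : ℤ) + 1
    · have h0 : t - ((m + 1 : ℕ) : ℤ) + ((0 : Fin (m + 1)).1 : ℤ) ≤ 0 := by
        simp; omega
      rw [if_pos h0, min_eq_left (by omega), min_eq_left (by push_cast; omega), zero_add]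
    · have h0 : ¬ t - ((m + 1 : ℕ) : ℤ) + ((0 : Fin (m + 1)).1 : ℤ) ≤ 0 := by
        simp; omega
      rw [if_neg h0, min_eq_right (by omega), min_eq_right (by push_cast; omega)]
      push_cast
      ring

lemma sum_min_ge (m T : ℕ) :
    ((T : ℝ) - m) * m ≤
      ∑ t ∈ Finset.Icc (1 : ℤ) (T : ℤ), ((min (t - 1) (m : ℤ) : ℤ) : ℝ) := by
  induction T with
  | zero => simp; positivity
  | succ T ih =>
    have hI : Finset.Icc (1 : ℤ) ((T + 1 : ℕ) : ℤ) =
        insert ((T : ℤ) + 1) (Finset.Icc (1 : ℤ) (T : ℤ)) := by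
      ext x; simp only [Finset.mem_Icc, Finset.mem_insert]; push_cast; omega
    rw [hI, Finset.sum_insert (by simp), add_sub_cancel_right]
    rcases le_or_gt (m : ℤ) (T : ℤ) with h | h
    · rw [min_eq_right h]
      push_cast at ih ⊢
      linarith
    · have h1 : (T : ℝ) + 1 ≤ m := by exact_mod_cast h
      have h2 : 0 ≤ ∑ t ∈ Finset.Icc (1 : ℤ) (T : ℤ), ((min (t - 1) (m : ℤ) : ℤ) : ℝ) :=
        Finset.sum_nonneg fun t ht => by
          have := (Finset.mem_Icc.1 ht).1
          exact_mod_cast le_min (by omega) (by omega)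
      have h3 : (0 : ℝ) ≤ ((min (T : ℤ) (m : ℤ) : ℤ) : ℝ) := by
        exact_mod_cast le_min (by omega) (by omega)
      have h4 : (((T + 1 : ℕ) : ℝ) - m) * m ≤ 0 :=
        mul_nonpos_of_nonpos_of_nonneg (by push_cast; linarith) (by positivity)
      linarith

lemma eq_of_norm_sq_le_one_of_one_le {a : Fin 2 → ℝ} (ha : a 0 ^ 2 + a 1 ^ 2 ≤ 1)
    (h : 1 ≤ a 0) : a = ![1, 0] := by
  have h1 : a 1 = 0 := by
    apply pow_eq_zero_iff (two_ne_zero) |>.1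
    nlinarith [sq_nonneg (a 1)]
  have h0 : a 0 = 1 := by nlinarith [sq_nonneg (a 1)]
  ext i
  fin_cases i <;> simp [h0, h1]

/-- The reward in the rising instance, after a memory window filled with `e₁` and zero padding. -/
lemma rising_reward_window {m : ℕ} (ε : ℝ) (g : ℤ → (Fin 2 → ℝ)) (t : ℤ) (ht : 1 ≤ t)
    (hg : ∀ u : ℤ, u < t → g u = constSeq ![(1 : ℝ), 0] u) (a : Fin 2 → ℝ) :
    a 0 * ε + ∑ s : Fin m, (a 0 * g (t - (m : ℤ) + (s.1 : ℤ)) 0 +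
        a 1 * g (t - (m : ℤ) + (s.1 : ℤ)) 1) *
          (g (t - (m : ℤ) + (s.1 : ℤ)) 0 * ε + g (t - (m : ℤ) + (s.1 : ℤ)) 1) =
      ((1 + min (t - 1) (m : ℤ) : ℤ) : ℝ) * ε * a 0 := by
  have hs : ∀ s : Fin m, (a 0 * g (t - (m : ℤ) + (s.1 : ℤ)) 0 +
        a 1 * g (t - (m : ℤ) + (s.1 : ℤ)) 1) *
          (g (t - (m : ℤ) + (s.1 : ℤ)) 0 * ε + g (t - (m : ℤ) + (s.1 : ℤ)) 1) =
      if t - (m : ℤ) + (s.1 : ℤ) ≤ 0 then 0 else a 0 * ε := fun s => by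
    rw [hg _ (by have := s.2; omega), constSeq]
    split_ifs <;> simp
  simp only [hs]
  rw [sum_window_ite m t ht]
  push_cast
  ring

lemma rising_term_le {ε : ℝ} (hε : 0 < ε) {a h : Fin 2 → ℝ}
    (ha : a 0 ^ 2 + a 1 ^ 2 ≤ 1) (hh : h 0 ^ 2 + h 1 ^ 2 ≤ 1) :
    (a 0 * h 0 + a 1 * h 1) * (h 0 * ε + h 1) ≤ ε + 1 := by
  have h1 : |a 0 * h 0 + a 1 * h 1| ≤ 1 := by
    rw [abs_le]
    constructor <;> nlinarith [sq_nonneg (a 0 + h 0), sq_nonneg (a 1 + h 1),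
      sq_nonneg (a 0 - h 0), sq_nonneg (a 1 - h 1)]
  have hh0 : |h 0| ≤ 1 := abs_le_one_iff_mul_self_le_one.2 (by nlinarith [sq_nonneg (h 1)])
  have hh1 : |h 1| ≤ 1 := abs_le_one_iff_mul_self_le_one.2 (by nlinarith [sq_nonneg (h 0)])
  have h2 : |h 0 * ε + h 1| ≤ ε + 1 := by
    rw [abs_le] at hh0 hh1 ⊢
    constructor <;> nlinarith
  calc _ ≤ |(a 0 * h 0 + a 1 * h 1) * (h 0 * ε + h 1)| := le_abs_self _
    _ = |a 0 * h 0 + a 1 * h 1| * |h 0 * ε + h 1| := abs_mul _ _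
    _ ≤ 1 * (ε + 1) := mul_le_mul h1 h2 (abs_nonneg _) zero_le_one
    _ = ε + 1 := one_mul _

/-- rising instance with non-isotropic initialization where oracle
greedy fails: on `ℝ²` with `θ* = (ε, 1)`, `A₀ = [[1,0],[0,0]]`, `γ = 1`, memory
matrix `A₀ + Σ h h ᵀ` and `0 < ε < m/(m+1)`: the greedy trajectory is uniquely the
constant sequence `e₁`, with total reward `Σ_{t=1}^T (1+min(t-1,m))ε ≤ T(m+1)ε`; the
constant sequence `e₂` has total reward `Σ_{t=1}^T min(t-1,m) ≥ (T-m)m`; hence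
greedy's regret is at least `(T-m)m - T(m+1)ε`, linear in `T`. -/
theorem stmt_5 (m : ℕ) (hm : 1 ≤ m) (ε : ℝ) (hε0 : 0 < ε)
    (hε1 : ε < (m : ℝ) / ((m : ℝ) + 1)) (T : ℕ)
    (θstar : Fin 2 → ℝ) (hθ : θstar = ![ε, 1])
    (A₀ : Matrix (Fin 2) (Fin 2) ℝ) (hA₀ : A₀ = !![1, 0; 0, 0])
    (f : (Fin m → (Fin 2 → ℝ)) → (Fin 2 → ℝ) → ℝ)
    (hf : ∀ (h : Fin m → (Fin 2 → ℝ)) (a : Fin 2 → ℝ),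
      f h a = a ⬝ᵥ (A₀ + ∑ s, vecMulVec (h s) (h s)).mulVec θstar) :
    -- (i) the constant sequence `e₁` is greedy, and it is the unique greedy trajectory
    IsGreedy m f (constSeq ![(1 : ℝ), 0]) ∧
    (∀ g : ℤ → (Fin 2 → ℝ), IsGreedy m f g →
      ∀ t : ℤ, 1 ≤ t → g t = ![(1 : ℝ), 0]) ∧
    totalReward m f T (constSeq ![(1 : ℝ), 0]) =
      ∑ t ∈ Finset.Icc (1 : ℤ) (T : ℤ), ((1 + min (t - 1) (m : ℤ) : ℤ) : ℝ) * ε ∧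
    (∑ t ∈ Finset.Icc (1 : ℤ) (T : ℤ), ((1 + min (t - 1) (m : ℤ) : ℤ) : ℝ) * ε) ≤
      (T : ℝ) * ((m : ℝ) + 1) * ε ∧
    -- (ii) the constant sequence `e₂`
    totalReward m f T (constSeq ![(0 : ℝ), 1]) =
      ∑ t ∈ Finset.Icc (1 : ℤ) (T : ℤ), ((min (t - 1) (m : ℤ) : ℤ) : ℝ) ∧
    (∑ t ∈ Finset.Icc (1 : ℤ) (T : ℤ), ((min (t - 1) (m : ℤ) : ℤ) : ℝ)) ≥
      ((T : ℝ) - (m : ℝ)) * (m : ℝ) ∧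
    -- consequently, the regret of oracle greedy is linear in `T`
    sSup (rewardSet m f {v : Fin 2 → ℝ | euclNorm v ≤ 1} T) -
        totalReward m f T (constSeq ![(1 : ℝ), 0]) ≥
      ((T : ℝ) - (m : ℝ)) * (m : ℝ) - (T : ℝ) * ((m : ℝ) + 1) * ε := by
  subst hθ hA₀
  simp only [rising_reward_eq] at hf
  have hc : ∀ t : ℤ, 1 ≤ t → (0 : ℝ) < ((1 + min (t - 1) (m : ℤ) : ℤ) : ℝ) * ε := fun t ht =>
    mul_pos (by
      have : (0 : ℤ) ≤ min (t - 1) (m : ℤ) := le_min (by omega) (by omega)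
      exact_mod_cast (by omega : (0 : ℤ) < 1 + min (t - 1) (m : ℤ))) hε0
  have hle1 : ∀ a : Fin 2 → ℝ, euclNorm a ≤ 1 → a 0 ≤ 1 := fun a ha => by
    rw [euclNorm_fin_two_le_one_iff] at ha
    nlinarith [sq_nonneg (a 1), sq_nonneg (a 0 - 1)]
  have hn1 : euclNorm ![(1 : ℝ), 0] ≤ 1 := by simp [euclNorm_fin_two_le_one_iff]
  have hn2 : euclNorm ![(0 : ℝ), 1] ≤ 1 := by simp [euclNorm_fin_two_le_one_iff]
  have hconst : ∀ (v : Fin 2 → ℝ) (t : ℤ), 1 ≤ t → constSeq v t = v := fun v t ht =>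
    if_neg (by omega)
  have hpad : ∀ (v : Fin 2 → ℝ) (t : ℤ), t ≤ 0 → constSeq v t = 0 := fun v t ht => if_pos ht
  have hreward1 : totalReward m f T (constSeq ![(1 : ℝ), 0]) =
      ∑ t ∈ Finset.Icc (1 : ℤ) (T : ℤ), ((1 + min (t - 1) (m : ℤ) : ℤ) : ℝ) * ε := by
    refine Finset.sum_congr rfl fun t ht => ?_
    have ht1 := (Finset.mem_Icc.1 ht).1
    rw [instReward, hf, rising_reward_window ε _ t ht1 (fun _ _ => rfl), hconst _ t ht1]
    simp
  have hreward1_le : (∑ t ∈ Finset.Icc (1 : ℤ) (T : ℤ),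
      ((1 + min (t - 1) (m : ℤ) : ℤ) : ℝ) * ε) ≤ (T : ℝ) * ((m : ℝ) + 1) * ε := by
    have h : ∀ t ∈ Finset.Icc (1 : ℤ) (T : ℤ),
        ((1 + min (t - 1) (m : ℤ) : ℤ) : ℝ) * ε ≤ ((m : ℝ) + 1) * ε := fun t _ => by
      refine mul_le_mul_of_nonneg_right ?_ hε0.le
      have := min_le_right (t - 1) (m : ℤ)
      exact_mod_cast (by omega : 1 + min (t - 1) (m : ℤ) ≤ (m : ℤ) + 1)
    refine (Finset.sum_le_card_nsmul _ _ _ h).trans_eq ?_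
    simp [mul_assoc]
  have hreward2 : totalReward m f T (constSeq ![(0 : ℝ), 1]) =
      ∑ t ∈ Finset.Icc (1 : ℤ) (T : ℤ), ((min (t - 1) (m : ℤ) : ℤ) : ℝ) := by
    refine Finset.sum_congr rfl fun t ht => ?_
    have ht1 := (Finset.mem_Icc.1 ht).1
    rw [instReward, hf, hconst _ t ht1, ← mul_one ((min (t - 1) (m : ℤ) : ℤ) : ℝ),
      ← sum_window_ite m t ht1]
    simp only [cons_val_zero, cons_val_one, zero_mul, zero_add]
    refine Finset.sum_congr rfl fun s _ => ?_
    rw [constSeq]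
    split_ifs <;> simp
  refine ⟨⟨hpad _, fun t ht => ⟨by rwa [hconst _ t ht], fun a ha => ?_⟩⟩, fun g hg => ?_,
    hreward1, hreward1_le, hreward2, sum_min_ge m T, ?_⟩
  · rw [hf, hf, rising_reward_window ε _ t ht (fun _ _ => rfl),
      rising_reward_window ε _ t ht (fun _ _ => rfl), hconst _ t ht]
    exact mul_le_mul_of_nonneg_left (hle1 a ha) (hc t ht).le
  · have key : ∀ n : ℕ, ∀ t : ℤ, t ≤ n → g t = constSeq ![(1 : ℝ), 0] t := by
      intro n
      induction n with
      | zero => exact fun t ht => by rw [hg.1 t (by simpa using ht), hpad _ t (by simpa using ht)]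
      | succ n ih =>
        intro t ht
        by_cases htn : t ≤ n
        · exact ih t htn
        · have ht1 : 1 ≤ t := by omega
          have hprev : ∀ u : ℤ, u < t → g u = constSeq ![(1 : ℝ), 0] u := fun u hu =>
            ih u (by push_cast at ht; omega)
          obtain ⟨hnorm, hmax⟩ := hg.2 t ht1
          have h := hmax _ hn1
          rw [hf, hf, rising_reward_window ε _ t ht1 hprev,
            rising_reward_window ε _ t ht1 hprev] at h
          rw [hconst _ t ht1]
          exact eq_of_norm_sq_le_one_of_one_le ((euclNorm_fin_two_le_one_iff _).1 hnorm)
            (le_of_mul_le_mul_left h (hc t ht1))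
    intro t ht
    rw [key t.toNat t (Int.self_le_toNat t), hconst _ t ht]
  · have hbdd : BddAbove (rewardSet m f {v : Fin 2 → ℝ | euclNorm v ≤ 1} T) := by
      refine ⟨∑ t ∈ Finset.Icc (1 : ℤ) (T : ℤ), (ε + ∑ _s : Fin m, (ε + 1)), ?_⟩
      rintro x ⟨a, ha0, ha1, rfl⟩
      have hball : ∀ t : ℤ, t ≤ T → euclNorm (a t) ≤ 1 := fun t ht => by
        by_cases h : t ≤ 0
        · simp [ha0 t h, euclNorm_fin_two_le_one_iff]
        · exact ha1 t (by omega) ht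
      refine Finset.sum_le_sum fun t ht => ?_
      have htT := (Finset.mem_Icc.1 ht).2
      rw [instReward, hf]
      refine add_le_add ?_ (Finset.sum_le_sum fun s _ => ?_)
      · exact mul_le_of_le_one_left hε0.le (hle1 _ (hball t htT))
      · exact rising_term_le hε0 ((euclNorm_fin_two_le_one_iff _).1 (hball t htT))
          ((euclNorm_fin_two_le_one_iff _).1 (hball _ (by have := s.2; omega)))
    have hsup := le_csSup hbdd ⟨constSeq ![(0 : ℝ), 1], hpad _,
      fun t ht _ => by rw [hconst _ t ht]; exact hn2, rfl⟩
    have := sum_min_ge m T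
    linarith
end

section
/- Let d, L, n be positive integers, λ ≥ 1, B ≥ 1, β ≥ 1 real numbers, and θ* ∈ ℝ^d with ‖θ*‖₂ ≤ 1. For τ ∈ {1,…,n} and i ∈ {1,…,L} let b_{τ,i} ∈ ℝ^d with ‖b_{τ,i}‖₂ ≤ B, and let b̃_1,…,b̃_L ∈ ℝ^d with ‖b̃_i‖₂ ≤ B. Define V_0 = λ I_d and V_τ = V_{τ−1} + Σ_{i=1}^L b_{τ,i} b_{τ,i}ᵀ. Suppose for each τ ∈ {1,…,n} there exists θ̃_τ ∈ ℝ^d such that (i) ‖θ̃_τ − θ*‖_{V_{τ−1}} ≤ 2β and (ii) Σ_{i=1}^L ⟨b̃_i, θ*⟩ ≤ Σ_{i=1}^L ⟨b_{τ,i}, θ̃_τ⟩. Then Σ_{τ=1}^n ( Σ_{i=1}^L ⟨b̃_i, θ*⟩ − Σ_{i=1}^L ⟨b_{τ,i}, θ*⟩ ) ≤ 2√2 · L · B · β · √( nL · log( det(V_n) / λ^d ) ). -/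
open Finset Matrix

/-- The norm `‖x‖_M = √(xᵀ M x)` associated with a (positive definite) matrix `M`. -/
noncomputable def matNorm {d : ℕ} (M : Matrix (Fin d) (Fin d) ℝ) (x : Fin d → ℝ) : ℝ :=
  Real.sqrt (x ⬝ᵥ M.mulVec x)

/-- The Cauchy-Schwarz inequality for the bilinear form of a positive semidefinite matrix. -/
theorem Matrix.PosSemidef.sq_dotProduct_mulVec_le {ι : Type*} [Fintype ι]
    {M : Matrix ι ι ℝ} (hM : M.PosSemidef) (x y : ι → ℝ) :
    (x ⬝ᵥ M *ᵥ y) ^ 2 ≤ (x ⬝ᵥ M *ᵥ x) * (y ⬝ᵥ M *ᵥ y) := by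
  have hsymm : y ⬝ᵥ M *ᵥ x = x ⬝ᵥ M *ᵥ y := by
    have hT : Mᵀ = M := by simpa using hM.isHermitian.eq
    rw [dotProduct_comm, dotProduct_mulVec, ← mulVec_transpose, hT, dotProduct_comm,
      dotProduct_comm]
  have hdisc : discrim (y ⬝ᵥ M *ᵥ y) (2 * (x ⬝ᵥ M *ᵥ y)) (x ⬝ᵥ M *ᵥ x) ≤ 0 := by
    refine discrim_le_zero fun t => ?_
    have h := hM.dotProduct_mulVec_nonneg (x + t • y)
    simp only [star_trivial, mulVec_add, mulVec_smul, dotProduct_add, add_dotProduct,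
      smul_dotProduct, dotProduct_smul, smul_eq_mul, hsymm] at h
    linarith
  rw [discrim] at hdisc
  linarith

theorem Matrix.PosDef.mulVec_inv_mulVec {ι : Type*} [Fintype ι] [DecidableEq ι]
    {M : Matrix ι ι ℝ} (hM : M.PosDef) (x : ι → ℝ) : M *ᵥ (M⁻¹ *ᵥ x) = x := by
  rw [mulVec_mulVec, mul_nonsing_inv _ hM.det_pos.ne'.isUnit, one_mulVec]

/-- The Cauchy-Schwarz inequality between the norm of a positive definite matrix and its dual
norm. -/
theorem Matrix.PosDef.sq_dotProduct_le {ι : Type*} [Fintype ι] [DecidableEq ι]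
    {M : Matrix ι ι ℝ} (hM : M.PosDef) (x y : ι → ℝ) :
    (x ⬝ᵥ y) ^ 2 ≤ (x ⬝ᵥ M⁻¹ *ᵥ x) * (y ⬝ᵥ M *ᵥ y) := by
  have h := hM.posSemidef.sq_dotProduct_mulVec_le y (M⁻¹ *ᵥ x)
  rw [hM.mulVec_inv_mulVec, dotProduct_comm y x, dotProduct_comm _ x] at h
  linarith

theorem Matrix.PosDef.dotProduct_inv_mulVec_nonneg {ι : Type*} [Fintype ι] [DecidableEq ι]
    {M : Matrix ι ι ℝ} (hM : M.PosDef) (x : ι → ℝ) : 0 ≤ x ⬝ᵥ M⁻¹ *ᵥ x := by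
  simpa using hM.inv.posSemidef.dotProduct_mulVec_nonneg x

/-- If `1 ≤ M` in the Loewner order, then the quadratic form of `M⁻¹` is at most the squared
Euclidean norm. -/
theorem Matrix.PosDef.dotProduct_inv_mulVec_le {ι : Type*} [Fintype ι] [DecidableEq ι]
    {M : Matrix ι ι ℝ} (hM : M.PosDef) (h1 : (M - 1).PosSemidef) (x : ι → ℝ) :
    x ⬝ᵥ M⁻¹ *ᵥ x ≤ x ⬝ᵥ x := by
  set y := M⁻¹ *ᵥ x with hy
  have hs : 0 ≤ x ⬝ᵥ y := hM.dotProduct_inv_mulVec_nonneg x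
  have hyy : y ⬝ᵥ y ≤ x ⬝ᵥ y := by
    have h := h1.dotProduct_mulVec_nonneg y
    rw [star_trivial, sub_mulVec, one_mulVec, dotProduct_sub, hy, hM.mulVec_inv_mulVec,
      ← hy, dotProduct_comm y x] at h
    linarith
  have hsub : 0 ≤ (x - y) ⬝ᵥ (x - y) := by
    simpa using dotProduct_star_self_nonneg (x - y)
  simp only [sub_dotProduct, dotProduct_sub, dotProduct_comm y x] at hsub
  linarith

theorem Matrix.posSemidef_vecMulVec_self {ι : Type*} [Finite ι] (x : ι → ℝ) :
    (vecMulVec x x).PosSemidef := by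
  simpa using posSemidef_vecMulVec_self_star x

/-- The matrix determinant lemma for a symmetric rank-one update. -/
theorem Matrix.PosDef.det_add_vecMulVec_self {ι : Type*} [Fintype ι] [DecidableEq ι]
    {M : Matrix ι ι ℝ} (hM : M.PosDef) (x : ι → ℝ) :
    (M + vecMulVec x x).det = M.det * (1 + x ⬝ᵥ M⁻¹ *ᵥ x) := by
  rw [vecMulVec_eq Unit, det_add_replicateCol_mul_replicateRow hM.det_pos.ne'.isUnit,
    det_unique (n := Unit)]
  congr 1
  rw [add_apply, one_apply_eq, Matrix.mul_assoc, ← replicateCol_mulVec]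
  rfl

theorem Matrix.PosDef.det_le_det_add_sum_vecMulVec_self {ι κ : Type*} [Fintype ι] [DecidableEq ι]
    {M : Matrix ι ι ℝ} (hM : M.PosDef) (s : Finset κ) (x : κ → ι → ℝ) :
    M.det ≤ (M + ∑ i ∈ s, vecMulVec (x i) (x i)).det := by
  classical
  induction s using Finset.induction_on with
  | empty => simp
  | insert a s ha ih =>
    have hN : (M + ∑ i ∈ s, vecMulVec (x i) (x i)).PosDef :=
      hM.add_posSemidef (posSemidef_sum _ fun i _ => posSemidef_vecMulVec_self (x i))
    rw [Finset.sum_insert ha, add_comm (vecMulVec _ _), ← add_assoc, hN.det_add_vecMulVec_self]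
    nlinarith [mul_nonneg hN.det_pos.le (hN.dotProduct_inv_mulVec_nonneg (x a))]

/-- Each vector of a block update contributes its rank-one factor to the determinant. -/
theorem Matrix.PosDef.det_mul_le_det_add_sum_vecMulVec_self {ι κ : Type*} [Fintype ι]
    [DecidableEq ι] {M : Matrix ι ι ℝ} (hM : M.PosDef) {s : Finset κ} (x : κ → ι → ℝ) {j : κ}
    (hj : j ∈ s) :
    M.det * (1 + x j ⬝ᵥ M⁻¹ *ᵥ x j) ≤ (M + ∑ i ∈ s, vecMulVec (x i) (x i)).det := by
  classical
  rw [← Finset.add_sum_erase _ _ hj, ← add_assoc, ← hM.det_add_vecMulVec_self]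
  exact (hM.add_posSemidef (posSemidef_vecMulVec_self _)).det_le_det_add_sum_vecMulVec_self _ _

theorem le_two_mul_mul_log_one_add {s K : ℝ} (hs : 0 ≤ s) (hsK : s ≤ K) (hK : 1 ≤ K) :
    s ≤ 2 * K * Real.log (1 + s) := by
  have h := Real.le_log_one_add_of_nonneg hs
  rw [div_le_iff₀ (by linarith)] at h
  have hlog : 0 ≤ Real.log (1 + s) := Real.log_nonneg (by linarith)
  nlinarith [mul_le_mul_of_nonneg_left (show s + 2 ≤ 4 * K by linarith) hlog]

/-- The squared dual norm of a vector of a block update is controlled by the growth of the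
log-determinant over the block. -/
theorem Matrix.PosDef.dotProduct_inv_mulVec_le_log_det_sub {ι κ : Type*} [Fintype ι]
    [DecidableEq ι] {M : Matrix ι ι ℝ} (hM : M.PosDef) (h1 : (M - 1).PosSemidef) {s : Finset κ}
    (x : κ → ι → ℝ) {j : κ} (hj : j ∈ s) {K : ℝ} (hK : 1 ≤ K) (hx : x j ⬝ᵥ x j ≤ K) :
    x j ⬝ᵥ M⁻¹ *ᵥ x j ≤
      2 * K * (Real.log (M + ∑ i ∈ s, vecMulVec (x i) (x i)).det - Real.log M.det) := by
  have hs := hM.dotProduct_inv_mulVec_nonneg (x j)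
  refine (le_two_mul_mul_log_one_add hs
    ((hM.dotProduct_inv_mulVec_le h1 (x j)).trans hx) hK).trans ?_
  have h := Real.log_le_log (mul_pos hM.det_pos (by linarith))
    (hM.det_mul_le_det_add_sum_vecMulVec_self x hj)
  rw [Real.log_mul hM.det_pos.ne' (by linarith)] at h
  gcongr
  linarith

/-- Regret of one block in terms of the growth of the log-determinant over the block. -/
theorem sum_dotProduct_le_of_matNorm_le {d : ℕ} {κ : Type*} {M : Matrix (Fin d) (Fin d) ℝ}
    (hM : M.PosDef) (h1 : (M - 1).PosSemidef) (s : Finset κ) (x : κ → Fin d → ℝ)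
    {B r : ℝ} (hB : 1 ≤ B) (hx : ∀ i ∈ s, euclNorm (x i) ≤ B) {v : Fin d → ℝ}
    (hv : matNorm M v ≤ r) :
    ∑ i ∈ s, x i ⬝ᵥ v ≤ #s * (√2 * B * r *
      √(Real.log (M + ∑ i ∈ s, vecMulVec (x i) (x i)).det - Real.log M.det)) := by
  have hr : 0 ≤ r := (Real.sqrt_nonneg _).trans hv
  rw [← nsmul_eq_mul]
  refine Finset.sum_le_card_nsmul _ _ _ fun i hi => ?_
  have hxi : x i ⬝ᵥ x i ≤ B ^ 2 := by
    have h := (Real.sqrt_le_left (by linarith)).1 (hx i hi)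
    simpa [dotProduct, sq] using h
  have hs := hM.dotProduct_inv_mulVec_le_log_det_sub h1 x hi (one_le_pow₀ hB) hxi
  have hvr : v ⬝ᵥ M *ᵥ v ≤ r ^ 2 := (Real.sqrt_le_left hr).1 hv
  set ℓ := Real.log (M + ∑ i ∈ s, vecMulVec (x i) (x i)).det - Real.log M.det
  have hs0 := hM.dotProduct_inv_mulVec_nonneg (x i)
  have hv0 : 0 ≤ v ⬝ᵥ M *ᵥ v := by simpa using hM.posSemidef.dotProduct_mulVec_nonneg v
  have hℓ : 0 ≤ ℓ := nonneg_of_mul_nonneg_right (hs0.trans hs) (by positivity)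
  refine le_of_sq_le_sq ?_ (by positivity)
  calc (x i ⬝ᵥ v) ^ 2 ≤ (x i ⬝ᵥ M⁻¹ *ᵥ x i) * (v ⬝ᵥ M *ᵥ v) := hM.sq_dotProduct_le _ _
    _ ≤ (2 * B ^ 2 * ℓ) * r ^ 2 := by gcongr
    _ = (√2 * B * r * √ℓ) ^ 2 := by
      rw [mul_pow, mul_pow, mul_pow, Real.sq_sqrt hℓ, Real.sq_sqrt zero_le_two]
      ring

theorem sum_sqrt_le_sqrt_card_mul_sum {κ : Type*} (s : Finset κ) (f : κ → ℝ)
    (hf : ∀ i ∈ s, 0 ≤ f i) : ∑ i ∈ s, √(f i) ≤ √(#s * ∑ i ∈ s, f i) := by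
  refine Real.le_sqrt_of_sq_le (sq_sum_le_card_mul_sum_sq.trans_eq ?_)
  rw [Finset.sum_congr rfl fun i hi => Real.sq_sqrt (hf i hi)]

theorem sum_Icc_one_sub_pred (f : ℕ → ℝ) (n : ℕ) :
    ∑ k ∈ Finset.Icc 1 n, (f k - f (k - 1)) = f n - f 0 := by
  induction n with
  | zero => simp
  | succ n ih => rw [Finset.sum_Icc_succ_top (by lia), ih]; simp

/-- deterministic core of the refined OFUL-memory regret bound:
under the confidence-ellipsoid and optimism conditions, the block regret is bounded by
`2√2 · L · B · β · √(nL · log(det V_n / λ^d))`. -/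
theorem stmt_6 (d L n : ℕ) (hd : 0 < d) (hL : 0 < L) (hn : 0 < n)
    (lam B β : ℝ) (hlam : 1 ≤ lam) (hB : 1 ≤ B) (hβ : 1 ≤ β)
    (θstar : Fin d → ℝ) (hθ : euclNorm θstar ≤ 1)
    (b : ℕ → ℕ → (Fin d → ℝ))
    (hb : ∀ τ ∈ Finset.Icc 1 n, ∀ i ∈ Finset.Icc 1 L, euclNorm (b τ i) ≤ B)
    (btil : ℕ → (Fin d → ℝ)) (hbtil : ∀ i ∈ Finset.Icc 1 L, euclNorm (btil i) ≤ B)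
    (V : ℕ → Matrix (Fin d) (Fin d) ℝ)
    (hV : ∀ k : ℕ, V k = lam • (1 : Matrix (Fin d) (Fin d) ℝ) +
      ∑ τ' ∈ Finset.Icc 1 k, ∑ i ∈ Finset.Icc 1 L, vecMulVec (b τ' i) (b τ' i))
    (hopt : ∀ τ ∈ Finset.Icc 1 n, ∃ θtil : Fin d → ℝ,
      matNorm (V (τ - 1)) (θtil - θstar) ≤ 2 * β ∧
      (∑ i ∈ Finset.Icc 1 L, btil i ⬝ᵥ θstar) ≤ ∑ i ∈ Finset.Icc 1 L, b τ i ⬝ᵥ θtil) :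
    (∑ τ ∈ Finset.Icc 1 n, ((∑ i ∈ Finset.Icc 1 L, btil i ⬝ᵥ θstar) -
        ∑ i ∈ Finset.Icc 1 L, b τ i ⬝ᵥ θstar)) ≤
      2 * Real.sqrt 2 * (L : ℝ) * B * β *
        Real.sqrt ((n : ℝ) * (L : ℝ) * Real.log ((V n).det / lam ^ d)) := by
  have hVsub (k : ℕ) : (V k - 1).PosSemidef := by
    have h : V k - 1 = (lam - 1) • (1 : Matrix (Fin d) (Fin d) ℝ) +
        ∑ τ' ∈ Finset.Icc 1 k, ∑ i ∈ Finset.Icc 1 L, vecMulVec (b τ' i) (b τ' i) := by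
      rw [hV k, sub_smul, one_smul]; abel
    rw [h]
    exact (PosSemidef.one.smul (sub_nonneg.2 hlam)).add (posSemidef_sum _ fun _ _ =>
      posSemidef_sum _ fun _ _ => posSemidef_vecMulVec_self _)
  have hVpos (k : ℕ) : (V k).PosDef := by
    simpa using PosDef.one.add_posSemidef (hVsub k)
  have hVstep : ∀ τ ∈ Finset.Icc 1 n,
      V τ = V (τ - 1) + ∑ i ∈ Finset.Icc 1 L, vecMulVec (b τ i) (b τ i) := by
    intro τ hτ
    obtain ⟨k, rfl⟩ := Nat.exists_eq_add_of_le' (Finset.mem_Icc.1 hτ).1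
    rw [hV, hV, Nat.add_sub_cancel, Finset.sum_Icc_succ_top (by lia), add_assoc]
  set ℓ : ℕ → ℝ := fun τ => Real.log (V τ).det - Real.log (V (τ - 1)).det with hℓdef
  have hℓ : ∀ τ ∈ Finset.Icc 1 n, 0 ≤ ℓ τ := by
    intro τ hτ
    refine sub_nonneg.2 (Real.log_le_log (hVpos _).det_pos ?_)
    rw [hVstep τ hτ]
    exact (hVpos _).det_le_det_add_sum_vecMulVec_self _ _
  have hregret : ∀ τ ∈ Finset.Icc 1 n, (∑ i ∈ Finset.Icc 1 L, btil i ⬝ᵥ θstar) -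
      ∑ i ∈ Finset.Icc 1 L, b τ i ⬝ᵥ θstar ≤ 2 * √2 * L * B * β * √(ℓ τ) := by
    intro τ hτ
    obtain ⟨θtil, hconf, hle⟩ := hopt τ hτ
    have h := sum_dotProduct_le_of_matNorm_le (hVpos (τ - 1)) (hVsub _) (Finset.Icc 1 L) (b τ)
      hB (hb τ hτ) hconf
    rw [← hVstep τ hτ, Nat.card_Icc, Nat.add_sub_cancel] at h
    simp only [dotProduct_sub, Finset.sum_sub_distrib] at h
    simp only [hℓdef]
    linarith
  have hsum : ∑ τ ∈ Finset.Icc 1 n, ℓ τ = Real.log ((V n).det / lam ^ d) := by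
    rw [sum_Icc_one_sub_pred fun τ => Real.log (V τ).det,
      Real.log_div (hVpos n).det_pos.ne' (by positivity), hV 0]
    simp
  have hsum0 : 0 ≤ Real.log ((V n).det / lam ^ d) := hsum ▸ Finset.sum_nonneg hℓ
  have hL1 : (1 : ℝ) ≤ L := by exact_mod_cast hL
  refine (Finset.sum_le_sum hregret).trans ?_
  rw [← Finset.mul_sum]
  gcongr
  refine (sum_sqrt_le_sqrt_card_mul_sum _ _ hℓ).trans ?_
  rw [hsum, Nat.card_Icc, Nat.add_sub_cancel]
  gcongr
  exact le_mul_of_one_le_right (Nat.cast_nonneg n) hL1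
end

section
/- Let V be a symmetric positive definite d×d real matrix and let b_1, …, b_k ∈ ℝ^d. Then for every x ∈ ℝ^d, xᵀ ( V + Σ_{j=1}^k b_j b_jᵀ ) x ≤ ( 1 + Σ_{j=1}^k b_jᵀ V⁻¹ b_j ) · ( xᵀ V x ). -/
open Finset Matrix

/-- Cauchy–Schwarz for the dual pair of norms defined by `V` and `V⁻¹`. -/
theorem Matrix.PosDef.sq_dotProduct_le_s9 {n : Type*} [Fintype n] [DecidableEq n]
    {V : Matrix n n ℝ} (hV : V.PosDef) (b x : n → ℝ) :
    (x ⬝ᵥ b) ^ 2 ≤ (b ⬝ᵥ V⁻¹ *ᵥ b) * (x ⬝ᵥ V *ᵥ x) := by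
  have hVw : V *ᵥ (V⁻¹ *ᵥ b) = b := by
    rw [mulVec_mulVec, mul_nonsing_inv _ ((isUnit_iff_isUnit_det V).1 hV.isUnit), one_mulVec]
  have hVt : Vᵀ = V := by simpa [conjTranspose_eq_transpose_of_trivial] using hV.isHermitian.eq
  have hwx : (V⁻¹ *ᵥ b) ⬝ᵥ V *ᵥ x = x ⬝ᵥ b := by
    rw [dotProduct_mulVec, ← mulVec_transpose, hVt, hVw, dotProduct_comm]
  have key : discrim (x ⬝ᵥ V *ᵥ x) (2 * (x ⬝ᵥ b)) (b ⬝ᵥ V⁻¹ *ᵥ b) ≤ 0 := by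
    refine discrim_le_zero fun t => ?_
    have h := hV.posSemidef.dotProduct_mulVec_nonneg (t • x + V⁻¹ *ᵥ b)
    simp only [star_trivial, mulVec_add, mulVec_smul, hVw, add_dotProduct, dotProduct_add,
      smul_dotProduct, dotProduct_smul, smul_eq_mul, hwx] at h
    rw [dotProduct_comm (V⁻¹ *ᵥ b) b] at h
    linarith
  rw [discrim] at key
  linarith

/-- for a symmetric positive definite `V` and vectors `b_1, …, b_k`,
`xᵀ(V + Σ_j b_j b_jᵀ)x ≤ (1 + Σ_j b_jᵀ V⁻¹ b_j) · xᵀ V x` for every `x`. -/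
theorem stmt_9 (d k : ℕ) (V : Matrix (Fin d) (Fin d) ℝ) (hV : V.PosDef)
    (b : Fin k → (Fin d → ℝ)) (x : Fin d → ℝ) :
    x ⬝ᵥ (V + ∑ j, vecMulVec (b j) (b j)).mulVec x ≤
      (1 + ∑ j, b j ⬝ᵥ V⁻¹.mulVec (b j)) * (x ⬝ᵥ V.mulVec x) := by
  rw [add_mulVec, dotProduct_add, sum_mulVec, dotProduct_sum, add_mul, one_mul, sum_mul]
  gcongr with j
  refine le_of_eq_of_le ?_ (hV.sq_dotProduct_le_s9 (b j) x)
  rw [vecMulVec_mulVec, op_smul_eq_smul, dotProduct_smul, smul_eq_mul, dotProduct_comm (b j), sq]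
end

section
/- Let N ≥ 1 be an integer, let n_1, …, n_N be positive real numbers, let r_1, …, r_N be nonnegative real numbers, let ñ > 0 and r̃ ≥ 0 be real numbers, and let F ∈ ℝ. If Σ_{τ=1}^N ( r̃/ñ − r_τ/n_τ ) ≤ F, then ( (min_τ n_τ) / (max_τ n_τ) ) · ( r̃ · (Σ_{τ=1}^N n_τ) / ñ ) − Σ_{τ=1}^N r_τ ≤ (min_τ n_τ) · F. -/
open Finset

/-- averaging lemma for block-based bandit algorithms: a bound `F`
on the regret of per-step averaged rewards converts into a bound on the true regret
against a scaled comparator. -/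
theorem stmt_15 (N : ℕ) (hN : 1 ≤ N)
    (n : Fin N → ℝ) (hn : ∀ τ, 0 < n τ)
    (r : Fin N → ℝ) (hr : ∀ τ, 0 ≤ r τ)
    (ntil : ℝ) (hntil : 0 < ntil) (rtil : ℝ) (hrtil : 0 ≤ rtil) (F : ℝ)
    (nmin nmax : ℝ)
    (hmin : IsLeast (Set.range n) nmin) (hmax : IsGreatest (Set.range n) nmax)
    (hF : ∑ τ, (rtil / ntil - r τ / n τ) ≤ F) :
    (nmin / nmax) * (rtil * (∑ τ, n τ) / ntil) - ∑ τ, r τ ≤ nmin * F := by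
  obtain ⟨⟨a, rfl⟩, hmin⟩ := hmin
  obtain ⟨⟨b, rfl⟩, hmax⟩ := hmax
  refine le_trans ?_ (mul_le_mul_of_nonneg_left hF (hn a).le)
  rw [mul_div_right_comm, Finset.mul_sum, Finset.mul_sum, ← Finset.sum_sub_distrib,
    Finset.mul_sum]
  refine Finset.sum_le_sum fun τ _ => ?_
  have hreward : n a * (r τ / n τ) ≤ r τ := by
    rw [← mul_div_assoc, div_le_iff₀ (hn τ), mul_comm]
    exact mul_le_mul_of_nonneg_left (hmin ⟨τ, rfl⟩) (hr τ)
  have hcomparator : n a / n b * (rtil / ntil * n τ) ≤ n a * (rtil / ntil) := by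
    rw [div_mul_eq_mul_div, div_le_iff₀ (hn b), ← mul_assoc]
    exact mul_le_mul_of_nonneg_left (hmax ⟨τ, rfl⟩)
      (mul_nonneg (hn a).le (div_nonneg hrtil hntil.le))
  linarith
end
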